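/- arXiv:2202.04792 — 3 statements merged into one kernel-verified Lean document; each statement's English description precedes it below -/
import Mathlib

section
/- Let R be a d-dimensional Gorenstein local ring and M a finitely generated R-module. The following are equivalent: (i) for every torsion R-module C, if Tor_n^R(M,C) = 0 for some n ≥ d then Tor_i^R(M,C) = 0 for all i ≥ n; (ii) for every maximal Cohen-Macaulay R-module C that has rank, if Tor_n^R(M,C) = 0 for some n ≥ d then Tor_i^R(M,C) = 0 for all i ≥ n; (iii) for every R-module C with rank, if Tor_n^R(M,C) = 0 for some n ≥ d then Tor_i^R(M,C) = 0 for all i ≥ n. -/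
open CategoryTheory IsLocalRing

noncomputable section

variable (R : Type) [CommRing R]

/-- `Tor_i^R(M,N)` as a type. -/
abbrev TorM (i : ℕ) (M N : Type) [AddCommGroup M] [Module R M]
    [AddCommGroup N] [Module R N] : Type :=
  ((Tor (ModuleCat R) i).obj (ModuleCat.of R M)).obj (ModuleCat.of R N)

/-- `Ext^i_R(M,N)` as a type. -/
abbrev ExtM (i : ℕ) (M N : Type) [AddCommGroup M] [Module R M]
    [AddCommGroup N] [Module R N] : Type :=
  ((Ext R (ModuleCat R) i).obj (Opposite.op (ModuleCat.of R M))).obj (ModuleCat.of R N)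

/-- `M` is isomorphic to its `q`-th syzygy `Ω^q M` in a minimal free resolution. -/
def IsPeriodicSyzygy [IsLocalRing R] (M : Type) [AddCommGroup M] [Module R M]
    (q : ℕ) : Prop :=
  ∃ (n : ℕ → ℕ) (d : ∀ i : ℕ, ((Fin (n (i + 1)) → R) →ₗ[R] (Fin (n i) → R)))
    (g : (Fin (n 0) → R) →ₗ[R] M),
    Function.Surjective g ∧
    LinearMap.ker g = LinearMap.range (d 0) ∧
    (∀ i, LinearMap.ker (d i) = LinearMap.range (d (i + 1))) ∧
    LinearMap.ker g ≤ (maximalIdeal R) • (⊤ : Submodule R (Fin (n 0) → R)) ∧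
    (∀ i, LinearMap.range (d i) ≤ (maximalIdeal R) • (⊤ : Submodule R (Fin (n i) → R))) ∧
    Nonempty (M ≃ₗ[R] LinearMap.range (d (q - 1)))

/-- `M` is locally free on the punctured spectrum of the local ring `R`. -/
def LocFreePunctured [IsLocalRing R] (M : Type) [AddCommGroup M] [Module R M] : Prop :=
  ∀ (p : Ideal R) (_ : p.IsPrime), p ≠ maximalIdeal R →
    Module.Free (Localization.AtPrime p) (LocalizedModule p.primeCompl M)

/-- index type parametrizing all finitely generated `R`-modules (via presentations) -/
abbrev FGIdx := Σ n : ℕ, Submodule R (Fin n → R)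

abbrev idxMod (x : FGIdx R) : Type := (Fin x.1 → R) ⧸ x.2

/-- relations (from short exact sequences) defining the Grothendieck group, ℚ-coefficients -/
def gRelQ : Set (FGIdx R →₀ ℚ) :=
  { v | ∃ (x y z : FGIdx R) (f : idxMod R x →ₗ[R] idxMod R y)
      (g : idxMod R y →ₗ[R] idxMod R z),
      Function.Injective f ∧ Function.Surjective g ∧
      LinearMap.range f = LinearMap.ker g ∧
      v = Finsupp.single y 1 - Finsupp.single x 1 - Finsupp.single z 1 }

/-- relations defining the reduced Grothendieck group with ℚ-coefficients:
SES relations together with the class of `R` itself. -/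
def gRelQbar : Set (FGIdx R →₀ ℚ) :=
  gRelQ R ∪ { v | ∃ x : FGIdx R, Nonempty (idxMod R x ≃ₗ[R] R) ∧ v = Finsupp.single x 1 }

/-- The reduced Grothendieck group with rational coefficients `Ḡ(R)_ℚ`. -/
abbrev GbarQ : Type := (FGIdx R →₀ ℚ) ⧸ Submodule.span ℚ (gRelQbar R)

/-- `[N] = 0` in the reduced Grothendieck group with rational coefficients. -/
def ClassZeroQ (N : Type) [AddCommGroup N] [Module R N] : Prop :=
  ∀ x : FGIdx R, Nonempty (idxMod R x ≃ₗ[R] N) →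
    (Submodule.Quotient.mk (p := Submodule.span ℚ (gRelQbar R))
      (Finsupp.single x 1) : GbarQ R) = 0

/-- relations (from short exact sequences) defining the Grothendieck group `G(R)` -/
def gRelZ : Set (FGIdx R →₀ ℤ) :=
  { v | ∃ (x y z : FGIdx R) (f : idxMod R x →ₗ[R] idxMod R y)
      (g : idxMod R y →ₗ[R] idxMod R z),
      Function.Injective f ∧ Function.Surjective g ∧
      LinearMap.range f = LinearMap.ker g ∧
      v = Finsupp.single y 1 - Finsupp.single x 1 - Finsupp.single z 1 }

/-- The Grothendieck group `G(R)` of finitely generated `R`-modules. -/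
abbrev GZ : Type := (FGIdx R →₀ ℤ) ⧸ Submodule.span ℤ (gRelZ R)

open Classical in
noncomputable def gcl (N : Type) [AddCommGroup N] [Module R N] : GZ R :=
  if h : ∃ x : FGIdx R, Nonempty (idxMod R x ≃ₗ[R] N) then
    Submodule.Quotient.mk (p := Submodule.span ℤ (gRelZ R)) (Finsupp.single h.choose 1)
  else 0

/-- `[N] = 0` in the Grothendieck group `G(R)`. -/
def ClassZeroZ (N : Type) [AddCommGroup N] [Module R N] : Prop :=
  ∀ x : FGIdx R, Nonempty (idxMod R x ≃ₗ[R] N) →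
    (Submodule.Quotient.mk (p := Submodule.span ℤ (gRelZ R))
      (Finsupp.single x 1) : GZ R) = 0

/-- the residue field of a local ring, as an `R`-module -/
abbrev resF [IsLocalRing R] : Type := R ⧸ (maximalIdeal R)

/-- `R` is a Gorenstein local ring of Krull dimension `d`
(characterized by `Ext^i_R(k,R) = 0` for `i ≠ d` and `Ext^d_R(k,R) ≅ k`). -/
def IsGorensteinOfDim [IsLocalRing R] (d : ℕ) : Prop :=
  ringKrullDim R = d ∧
  (∀ i : ℕ, i ≠ d → Subsingleton (ExtM R i (resF R) R)) ∧
  Nonempty ((ExtM R d (resF R) R) ≃ₗ[R] resF R)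

/-- `R` is a Cohen-Macaulay local ring of Krull dimension `d` (depth R = dim R = d,
depth computed via `Ext^i(k,R)`). -/
def IsCMOfDim [IsLocalRing R] (d : ℕ) : Prop :=
  ringKrullDim R = d ∧
  (∀ i : ℕ, i < d → Subsingleton (ExtM R i (resF R) R)) ∧
  Nontrivial (ExtM R d (resF R) R)

/-- `ω` is a canonical module of the `d`-dimensional Cohen-Macaulay local ring `R`. -/
def IsCanonicalModule [IsLocalRing R] (d : ℕ) (ω : Type) [AddCommGroup ω] [Module R ω] : Prop :=
  Module.Finite R ω ∧
  (∀ i : ℕ, i ≠ d → Subsingleton (ExtM R i (resF R) ω)) ∧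
  Nonempty ((ExtM R d (resF R) ω) ≃ₗ[R] resF R)

/-- `M` has depth `d` and is maximal Cohen-Macaulay over the `d`-dimensional local ring `R`
(depth computed via `Ext^i(k,M)`). -/
def IsMCM [IsLocalRing R] (d : ℕ) (M : Type) [AddCommGroup M] [Module R M] : Prop :=
  (∀ i : ℕ, i < d → Subsingleton (ExtM R i (resF R) M)) ∧
  Nontrivial (ExtM R d (resF R) M)

/-- `M` has a free resolution of length at most `k` (so `pd_R M ≤ k`). -/
def PdLE (M : Type) [AddCommGroup M] [Module R M] (k : ℕ) : Prop :=
  ∃ (n : ℕ → ℕ) (d : ∀ i : ℕ, ((Fin (n (i + 1)) → R) →ₗ[R] (Fin (n i) → R)))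
    (g : (Fin (n 0) → R) →ₗ[R] M),
    Function.Surjective g ∧
    LinearMap.ker g = LinearMap.range (d 0) ∧
    (∀ i, LinearMap.ker (d i) = LinearMap.range (d (i + 1))) ∧
    (∀ i, k < i → n i = 0)

/-- `G` is a totally reflexive `R`-module. -/
def IsTotallyReflexive (G : Type) [AddCommGroup G] [Module R G] : Prop :=
  Module.Finite R G ∧
  Function.Bijective (Module.Dual.eval R G) ∧
  (∀ i : ℕ, 1 ≤ i → Subsingleton (ExtM R i G R)) ∧
  (∀ i : ℕ, 1 ≤ i → Subsingleton (ExtM R i (Module.Dual R G) R))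

/-- `M` has a resolution by totally reflexive modules of length at most `g`
(so `Gdim_R M ≤ g`). -/
def GdimLE (M : Type) [AddCommGroup M] [Module R M] (g : ℕ) : Prop :=
  ∃ (G : ℕ → ModuleCat R) (d : ∀ i : ℕ, ((G (i + 1) : Type) →ₗ[R] (G i : Type)))
    (ε : (G 0 : Type) →ₗ[R] M),
    (∀ i, IsTotallyReflexive R (G i)) ∧
    Function.Surjective ε ∧
    LinearMap.ker ε = LinearMap.range (d 0) ∧
    (∀ i, LinearMap.ker (d i) = LinearMap.range (d (i + 1))) ∧
    (∀ i, g < i → Subsingleton (G i : Type))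

open Classical in
noncomputable def mlen (M : Type) [AddCommGroup M] [Module R M] : ℕ :=
  if h : ∃ s : CompositionSeries (Submodule R M), s.head = ⊥ ∧ s.last = ⊤ then
    h.choose.length
  else 0

/-- Hochster's theta invariant `θ(M,N)` computed using `Tor_{2n}` and `Tor_{2n-1}`. -/
noncomputable def theta (M N : Type) [AddCommGroup M] [Module R M]
    [AddCommGroup N] [Module R N] (n : ℕ) : ℤ :=
  (mlen R (TorM R (2 * n) M N) : ℤ) - (mlen R (TorM R (2 * n - 1) M N) : ℤ)

/-- `C` has rank `r`: localization at every associated prime of `R` is free of rank `r`. -/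
def HasRankN (C : Type) [AddCommGroup C] [Module R C] (r : ℕ) : Prop :=
  ∀ (p : Ideal R) (_ : p.IsPrime), p ∈ associatedPrimes R R →
    Nonempty ((LocalizedModule p.primeCompl C) ≃ₗ[Localization.AtPrime p]
      (Fin r → Localization.AtPrime p))

end



section TorPart

open Limits

universe v u

theorem exists_aug {C : Type u} [Category.{v} C] [Abelian C] {K : C} (P : ProjectiveResolution K) :
    ∃ (e : P.complex.X 0 ⟶ K) (w : P.complex.d 1 0 ≫ e = 0), Epi e ∧
      (ShortComplex.mk _ _ w).Exact := by
  refine ⟨P.π.f 0, P.complex_d_comp_π_f_zero, ?_, ?_⟩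
  · exact inferInstanceAs (Epi (P.π.f 0))
  · exact ShortComplex.exact_of_g_is_cokernel _ P.isColimitCokernelCofork

/-- splicing a projective resolution of the kernel -/
noncomputable def splice {C : Type u} [Category.{v} C] [Abelian C] (S : ShortComplex C) (hS : S.ShortExact)
    (hp : Projective S.X₂) (P : ProjectiveResolution S.X₁) (e : P.complex.X 0 ⟶ S.X₁)
    (w : P.complex.d 1 0 ≫ e = 0) (he : Epi e) (hex : (ShortComplex.mk _ _ w).Exact) :
    ProjectiveResolution S.X₃ where
  complex := ChainComplex.augment P.complex (e ≫ S.f) (by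
    rw [← Category.assoc, w, zero_comp])
  projective n := by
    cases n with
    | zero => exact hp
    | succ n => exact P.projective n
  π := (ChainComplex.toSingle₀Equiv _ _).symm ⟨S.g, by
    change (e ≫ S.f) ≫ S.g = 0
    rw [Category.assoc, S.zero, comp_zero]⟩
  quasiIso := ⟨fun n => by
    have := hS.mono_f
    have := hS.epi_g
    match n with
    | 0 =>
      rw [ChainComplex.quasiIsoAt₀_iff, ShortComplex.quasiIso_iff_of_zeros']
      · refine (ShortComplex.exact_and_epi_g_iff_of_iso (S₂ := ShortComplex.mk (e ≫ S.f) S.g (by rw [Category.assoc, S.zero, comp_zero])) ?_).2 ⟨?_, hS.epi_g⟩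
        · refine ShortComplex.isoMk (Iso.refl _) (Iso.refl _) (Iso.refl _)
            ?_ ?_
          · exact (Category.id_comp _).trans (Category.comp_id _).symm
          · refine (Category.id_comp _).trans (Eq.trans ?_ (Category.comp_id _).symm)
            exact (ChainComplex.toSingle₀Equiv_symm_apply_f_zero (C := ChainComplex.augment P.complex (e ≫ S.f) (by
                rw [← Category.assoc, w, zero_comp])) _ _).symm
        · let φ : ShortComplex.mk (e ≫ S.f) S.g (by rw [Category.assoc, S.zero, comp_zero]) ⟶ S :=
            { τ₁ := e
              τ₂ := 𝟙 _
              τ₃ := 𝟙 _ }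
          have : Epi φ.τ₁ := he
          have : IsIso φ.τ₂ := inferInstanceAs (IsIso (𝟙 _))
          have : Mono φ.τ₃ := inferInstanceAs (Mono (𝟙 _))
          exact (ShortComplex.exact_iff_of_epi_of_isIso_of_mono φ).2 hS.exact
      all_goals rfl
    | 1 =>
      rw [quasiIsoAt_iff_exactAt']
      · rw [HomologicalComplex.exactAt_iff' _ 2 1 0 (by simp) (by simp)]
        let φ : ShortComplex.mk _ _ w ⟶ ShortComplex.mk (P.complex.d 1 0) (e ≫ S.f) (by
            rw [← Category.assoc, w, zero_comp]) :=
            { τ₁ := 𝟙 _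
              τ₂ := 𝟙 _
              τ₃ := S.f }
        have : Epi φ.τ₁ := inferInstanceAs (Epi (𝟙 _))
        have : IsIso φ.τ₂ := inferInstanceAs (IsIso (𝟙 _))
        have : Mono φ.τ₃ := inferInstanceAs (Mono S.f)
        exact (ShortComplex.exact_iff_of_epi_of_isIso_of_mono φ).1 hex
      · apply ChainComplex.exactAt_succ_single_obj
    | n + 2 =>
      rw [quasiIsoAt_iff_exactAt']
      · rw [HomologicalComplex.exactAt_iff' _ (n+3) (n+2) (n+1) (by simp) (by simp)]
        exact P.exact_succ n
      · apply ChainComplex.exactAt_succ_single_obj⟩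

theorem leftDerived_isZero_iff {C : Type u} [Category.{v} C] [Abelian C]
    [HasProjectiveResolutions C]
    (F : C ⥤ C) [F.Additive] {X : C} (P : ProjectiveResolution X) (n : ℕ) :
    IsZero ((F.leftDerived (n+1)).obj X) ↔ (ShortComplex.mk (F.map (P.complex.d (n+2) (n+1)))
      (F.map (P.complex.d (n+1) n)) (by rw [← F.map_comp, P.complex.d_comp_d, F.map_zero])).Exact := by
  rw [(P.isoLeftDerivedObj F (n+1)).isZero_iff]
  change IsZero ((((F.mapHomologicalComplex _).obj P.complex)).homology (n+1)) ↔ _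
  rw [← HomologicalComplex.exactAt_iff_isZero_homology,
    HomologicalComplex.exactAt_iff' _ (n+2) (n+1) n (by simp) (by simp)]
  rfl

theorem shift_succ {C : Type u} [Category.{v} C] [Abelian C]
    [HasProjectiveResolutions C]
    (F : C ⥤ C) [F.Additive] (S : ShortComplex C) (hS : S.ShortExact)
    (hp : Projective S.X₂) (n : ℕ) :
    IsZero ((F.leftDerived (n+2)).obj S.X₃) ↔ IsZero ((F.leftDerived (n+1)).obj S.X₁) := by
  let P := projectiveResolution S.X₁
  obtain ⟨e, w, he, hex⟩ := exists_aug P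
  rw [leftDerived_isZero_iff F P, leftDerived_isZero_iff F (splice S hS hp P e w he hex)]
  rfl

theorem shift_one {R : Type} [CommRing R]
    (F : ModuleCat.{0} R ⥤ ModuleCat.{0} R) [F.Additive] [PreservesFiniteColimits F]
    (S : ShortComplex (ModuleCat.{0} R)) (hS : S.ShortExact)
    (hp : Projective S.X₂) :
    IsZero ((F.leftDerived 1).obj S.X₃) ↔ Function.Injective (F.map S.f) := by
  let P := projectiveResolution S.X₁
  obtain ⟨e, w, he, hex⟩ := exists_aug P
  rw [leftDerived_isZero_iff F (splice S hS hp P e w he hex)]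
  have hT := hex.map_of_epi_of_preservesCokernel F he inferInstance
  have hepi : Function.Surjective (F.map e) := (ModuleCat.epi_iff_surjective _).1 inferInstance
  change (ShortComplex.mk (F.map (P.complex.d 1 0)) (F.map (e ≫ S.f)) _).Exact ↔ _
  rw [ShortComplex.moduleCat_exact_iff] at hT ⊢
  constructor
  · intro h
    rw [injective_iff_map_eq_zero]
    intro z hz
    obtain ⟨y, rfl⟩ := hepi z
    obtain ⟨x, rfl⟩ := h y (by simpa using hz)
    change (F.map (P.complex.d 1 0) ≫ F.map e) x = 0
    rw [← F.map_comp, w, F.map_zero]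
    rfl
  · intro h y hy
    refine hT y ?_
    rw [injective_iff_map_eq_zero] at h
    refine h _ ?_
    change (F.map e ≫ F.map S.f) y = 0
    rw [← F.map_comp]
    exact hy

variable {R : Type} [CommRing R] (M : Type) [AddCommGroup M] [Module R M]

theorem modCat_shortExact {A B C : Type} [AddCommGroup A] [AddCommGroup B] [AddCommGroup C]
    [Module R A] [Module R B] [Module R C] (f : A →ₗ[R] B) (g : B →ₗ[R] C)
    (hf : Function.Injective f) (hfg : Function.Exact f g) (hg : Function.Surjective g) :
    (ShortComplex.mk (ModuleCat.ofHom f) (ModuleCat.ofHom g)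
      (by ext x; exact hfg.apply_apply_eq_zero x)).ShortExact where
  exact := by
    rw [ShortComplex.moduleCat_exact_iff]
    intro x hx
    exact (hfg x).1 hx
  mono_f := (ModuleCat.mono_iff_injective _).2 hf
  epi_g := (ModuleCat.epi_iff_surjective _).2 hg

theorem torM_sub_iff (n : ℕ) (N : Type) [AddCommGroup N] [Module R N] :
    Subsingleton (TorM R n M N) ↔ IsZero (((Tor (ModuleCat R) n).obj (ModuleCat.of R M)).obj
      (ModuleCat.of R N)) := ModuleCat.isZero_iff_subsingleton.symm

theorem tor_shift {A B C : Type} [AddCommGroup A] [AddCommGroup B] [AddCommGroup C]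
    [Module R A] [Module R B] [Module R C] [Module.Projective R B]
    (f : A →ₗ[R] B) (g : B →ₗ[R] C)
    (hf : Function.Injective f) (hfg : Function.Exact f g) (hg : Function.Surjective g) (n : ℕ) :
    Subsingleton (TorM R (n+2) M C) ↔ Subsingleton (TorM R (n+1) M A) := by
  rw [torM_sub_iff, torM_sub_iff]
  exact shift_succ ((MonoidalCategory.tensoringLeft (ModuleCat R)).obj (ModuleCat.of R M)) _
    (modCat_shortExact f g hf hfg hg) (inferInstanceAs (Projective (ModuleCat.of R B))) n

instance tens_pres : PreservesFiniteColimits ((MonoidalCategory.tensoringLeft (ModuleCat.{0} R)).obj (ModuleCat.of R M)) :=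
  inferInstanceAs (PreservesFiniteColimits (MonoidalCategory.tensorLeft (ModuleCat.of R M)))

theorem tor_shift_one {A B C : Type} [AddCommGroup A] [AddCommGroup B] [AddCommGroup C]
    [Module R A] [Module R B] [Module R C] [Module.Projective R B]
    (f : A →ₗ[R] B) (g : B →ₗ[R] C)
    (hf : Function.Injective f) (hfg : Function.Exact f g) (hg : Function.Surjective g) :
    Subsingleton (TorM R 1 M C) ↔ Function.Injective (f.lTensor M) := by
  rw [torM_sub_iff]
  exact shift_one ((MonoidalCategory.tensoringLeft (ModuleCat R)).obj (ModuleCat.of R M)) _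
    (modCat_shortExact f g hf hfg hg) (inferInstanceAs (Projective (ModuleCat.of R B)))

theorem tor_zero {A : Type} [AddCommGroup A] [Module R A] :
    Subsingleton (TorM R 0 M A) ↔ Subsingleton (TensorProduct R M A) := by
  rw [torM_sub_iff]
  have e := ((MonoidalCategory.tensoringLeft (ModuleCat R)).obj (ModuleCat.of R M)).leftDerivedZeroIsoSelf.app (ModuleCat.of R A)
  exact e.isZero_iff.trans ModuleCat.isZero_iff_subsingleton

theorem tor_prod_aux {A B P K : Type} [AddCommGroup A] [Module R A] [AddCommGroup B] [Module R B]
    [AddCommGroup P] [Module R P] [AddCommGroup K] [Module R K]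
    [Module.Projective R B] [Module.Projective R P] (n : ℕ) (ι : K →ₗ[R] P) (f : P →ₗ[R] A)
    (hι : Function.Injective ι) (hex : Function.Exact ι f) (hf : Function.Surjective f) :
    Subsingleton (TorM R (n+1) M (A × B)) ↔ Subsingleton (TorM R (n+1) M A) := by
  have hι2 : Function.Injective (LinearMap.inl R P B ∘ₗ ι) :=
    LinearMap.inl_injective.comp hι
  have hex2 : Function.Exact (LinearMap.inl R P B ∘ₗ ι) (f.prodMap (LinearMap.id (M := B))) := by
    rintro ⟨x, y⟩
    constructor
    · intro h
      rw [LinearMap.prodMap_apply, Prod.mk_eq_zero] at h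
      obtain ⟨z, hz⟩ := (hex x).1 h.1
      exact ⟨z, Prod.ext hz h.2.symm⟩
    · rintro ⟨z, hz⟩
      rw [← hz, LinearMap.prodMap_apply, Prod.mk_eq_zero]
      exact ⟨hex.apply_apply_eq_zero z, rfl⟩
  have hf2 : Function.Surjective (f.prodMap (LinearMap.id (M := B))) := by
    rintro ⟨x, y⟩
    obtain ⟨z, rfl⟩ := hf x
    exact ⟨(z, y), rfl⟩
  cases n with
  | zero =>
    refine (tor_shift_one M _ _ hι2 hex2 hf2).trans
      (Iff.trans ?_ (tor_shift_one M _ _ hι hex hf).symm)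
    rw [LinearMap.lTensor_comp]
    have : Function.Injective ((LinearMap.inl R P B).lTensor M) := by
      apply Function.LeftInverse.injective (g := ((LinearMap.fst R P B).lTensor M))
      intro x
      rw [← LinearMap.comp_apply, ← LinearMap.lTensor_comp, LinearMap.fst_comp_inl, LinearMap.lTensor_id]
      rfl
    exact this.of_comp_iff _
  | succ n =>
    exact (tor_shift M _ _ hι2 hex2 hf2 n).trans (tor_shift M _ _ hι hex hf n).symm

theorem tor_prod {A B : Type} [AddCommGroup A] [Module R A] [AddCommGroup B] [Module R B]
    [Module.Projective R B] (n : ℕ) :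
    Subsingleton (TorM R (n+1) M (A × B)) ↔ Subsingleton (TorM R (n+1) M A) :=
  tor_prod_aux M (P := A →₀ R) (K := LinearMap.ker (Finsupp.linearCombination R (id : A → A))) n
    (LinearMap.ker (Finsupp.linearCombination R (id : A → A))).subtype
    (Finsupp.linearCombination R (id : A → A)) Subtype.val_injective
    (LinearMap.exact_subtype_ker_map _) (Finsupp.linearCombination_id_surjective R A)

theorem tor_congr {A B : Type} [AddCommGroup A] [Module R A] [AddCommGroup B] [Module R B]
    (e : A ≃ₗ[R] B) (n : ℕ) :
    Subsingleton (TorM R n M A) ↔ Subsingleton (TorM R n M B) := by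
  rw [torM_sub_iff, torM_sub_iff]
  exact (((Tor (ModuleCat R) n).obj (ModuleCat.of R M)).mapIso e.toModuleIso).isZero_iff

end TorPart


section TorQuot

variable {R : Type} [CommRing R] (M : Type) [AddCommGroup M] [Module R M]

theorem tor_quot_aux {B X T P K : Type} [AddCommGroup B] [Module R B] [AddCommGroup X] [Module R X]
    [AddCommGroup P] [Module R P] [AddCommGroup K] [Module R K] [AddCommGroup T] [Module R T]
    [Module.Projective R B] [Module.Projective R P] (n : ℕ) (ι : K →ₗ[R] P) (π : P →ₗ[R] X)
    (hι : Function.Injective ι) (hex : Function.Exact ι π) (hπ : Function.Surjective π)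
    (f : B →ₗ[R] X) (g : X →ₗ[R] T) (hf : Function.Injective f) (hfg : Function.Exact f g)
    (hg : Function.Surjective g) :
    Subsingleton (TorM R (n+2) M T) ↔ Subsingleton (TorM R (n+2) M X) := by
  obtain ⟨l, hl⟩ := Module.projective_lifting_property π f hπ
  have hl' : ∀ b, π (l b) = f b := fun b => by rw [← hl]; rfl
  have h1 : Function.Injective (ι.coprod l) := by
    rw [injective_iff_map_eq_zero]
    rintro ⟨k, b⟩ h
    rw [LinearMap.coprod_apply] at h
    have h2 := congrArg π h
    rw [map_add, hex.apply_apply_eq_zero, hl', zero_add, map_zero] at h2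
    have hb := (injective_iff_map_eq_zero f).1 hf _ h2
    subst hb
    rw [map_zero, add_zero] at h
    exact Prod.ext ((injective_iff_map_eq_zero ι).1 hι _ h) rfl
  have h2 : Function.Exact (ι.coprod l) (g ∘ₗ π) := by
    intro x
    constructor
    · intro h
      obtain ⟨b, hb⟩ := (hfg _).1 h
      obtain ⟨k, hk⟩ := (hex (x - l b)).1 (by rw [map_sub, hl', hb, sub_self])
      exact ⟨(k, b), by simp [hk]⟩
    · rintro ⟨⟨k, b⟩, rfl⟩
      simp [hl', hex.apply_apply_eq_zero, hfg.apply_apply_eq_zero]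
  exact (tor_shift M _ _ h1 h2 (hg.comp hπ) n).trans ((tor_prod M n).trans
    (tor_shift M _ _ hι hex hπ n).symm)

theorem tor_quot {B X T : Type} [AddCommGroup B] [Module R B] [AddCommGroup X] [Module R X]
    [AddCommGroup T] [Module R T]
    [Module.Projective R B] (n : ℕ)
    (f : B →ₗ[R] X) (g : X →ₗ[R] T) (hf : Function.Injective f) (hfg : Function.Exact f g)
    (hg : Function.Surjective g) :
    Subsingleton (TorM R (n+2) M T) ↔ Subsingleton (TorM R (n+2) M X) :=
  tor_quot_aux M (P := X →₀ R) (K := LinearMap.ker (Finsupp.linearCombination R (id : X → X))) n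
    (LinearMap.ker (Finsupp.linearCombination R (id : X → X))).subtype
    (Finsupp.linearCombination R (id : X → X)) Subtype.val_injective
    (LinearMap.exact_subtype_ker_map _) (Finsupp.linearCombination_id_surjective R X) f g hf hfg hg

end TorQuot


section ExtPart

open Limits

variable {R : Type} [CommRing R]

/-- vanishing of `Ext^n(A,B)` (derived category version) -/
def EV (R : Type) [CommRing R] (n : ℕ) (A B : Type) [AddCommGroup A] [Module R A]
    [AddCommGroup B] [Module R B] : Prop :=
  Subsingleton (Abelian.Ext (ModuleCat.of R A) (ModuleCat.of R B) n)

theorem extM_iff (n : ℕ) (A B : Type) [AddCommGroup A] [Module R A]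
    [AddCommGroup B] [Module R B] : Subsingleton (ExtM R n A B) ↔ EV R n A B := by
  unfold EV
  let P := projectiveResolution (ModuleCat.of R A)
  have h1 : Subsingleton (ExtM R n A B) ↔ (P.complex.linearYonedaObj R (ModuleCat.of R B)).ExactAt n := by
    rw [HomologicalComplex.exactAt_iff_isZero_homology, ← (P.isoExt (R := R) n (ModuleCat.of R B)).isZero_iff]
    exact ModuleCat.isZero_iff_subsingleton.symm
  rw [h1]
  cases n with
  | zero =>
    have e := Abelian.Ext.addEquiv₀ (X := ModuleCat.of R A) (Y := ModuleCat.of R B)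
    rw [e.toEquiv.subsingleton_congr]
    rw [HomologicalComplex.exactAt_iff' _ 0 0 1 (by simp) (by simp),
      ShortComplex.moduleCat_exact_iff]
    obtain ⟨a, w, he, hex⟩ := exists_aug P
    have key : ∀ φ : P.complex.X 0 ⟶ ModuleCat.of R B, P.complex.d 1 0 ≫ φ = 0 →
        ∃ ψ, φ = a ≫ ψ := fun φ hφ => ⟨hex.desc φ hφ, (hex.g_desc φ hφ).symm⟩
    constructor
    · intro h
      refine ⟨fun x y => ?_⟩
      suffices H : ∀ x : ModuleCat.of R A ⟶ ModuleCat.of R B, x = 0 by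
        rw [H x, H y]
      intro x
      obtain ⟨g, hg⟩ := h (a ≫ x) (by
        change P.complex.d 1 0 ≫ (a ≫ x) = 0
        rw [← Category.assoc, w, zero_comp])
      have hz : ∀ g' : P.complex.X 0 ⟶ ModuleCat.of R B, P.complex.d 0 0 ≫ g' = 0 := by
        intro g'
        rw [P.complex.shape 0 0 (by simp), zero_comp]
      have hg2 : a ≫ x = 0 := Eq.trans (Eq.symm hg) (hz g)
      exact (cancel_epi a).1 (hg2.trans comp_zero.symm)
    · intro h φ hφ
      refine ⟨0, ?_⟩
      obtain ⟨ψ, hψ⟩ := key φ hφ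
      rw [Subsingleton.elim ψ 0, comp_zero] at hψ
      rw [hψ]
      exact map_zero _
  | succ n =>
    rw [HomologicalComplex.exactAt_iff' _ n (n+1) (n+2) (by simp) (by simp),
      ShortComplex.moduleCat_exact_iff]
    constructor
    · intro h
      refine ⟨fun a b => ?_⟩
      suffices H : ∀ a : Abelian.Ext (ModuleCat.of R A) (ModuleCat.of R B) (n+1), a = 0 by
        rw [H a, H b]
      intro a
      obtain ⟨f, hf, rfl⟩ := P.extMk_surjective a (n+2) rfl
      rw [P.extMk_eq_zero_iff _ _ _ _ n rfl]
      obtain ⟨g, hg⟩ := h f hf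
      exact ⟨g, hg⟩
    · intro h f hf
      have := (P.extMk_eq_zero_iff f (n+2) rfl hf n rfl).1 (Subsingleton.elim _ _)
      obtain ⟨g, hg⟩ := this
      exact ⟨g, hg⟩

section LES

variable {A B C : Type} [AddCommGroup A] [AddCommGroup B] [AddCommGroup C]
    [Module R A] [Module R B] [Module R C] {f : A →ₗ[R] B} {g : B →ₗ[R] C}

theorem ev_iff (n : ℕ) (A B : Type) [AddCommGroup A] [Module R A]
    [AddCommGroup B] [Module R B] : EV R n A B ↔
      ∀ x : Abelian.Ext (ModuleCat.of R A) (ModuleCat.of R B) n, x = 0 :=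
  ⟨fun h x => @Subsingleton.elim _ h x 0, fun h => ⟨fun x y => by rw [h x, h y]⟩⟩

theorem ev_proj (Y : Type) [AddCommGroup Y] [Module R Y] (n : ℕ) [Module.Projective R A] : EV R (n+1) A Y := by
  rw [ev_iff]
  intro x
  exact Abelian.Ext.eq_zero_of_projective x

theorem ev_mid (hf : Function.Injective f) (hfg : Function.Exact f g) (hg : Function.Surjective g)
    (Y : Type) [AddCommGroup Y] [Module R Y]
    (n : ℕ) (hA : EV R n A Y) (hC : EV R n C Y) : EV R n B Y := by
  rw [ev_iff] at *
  intro x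
  obtain ⟨y, hy⟩ := Abelian.Ext.contravariant_sequence_exact₂ (modCat_shortExact f g hf hfg hg)
    (ModuleCat.of R Y) x (hA _)
  rw [← hy, hC y, Abelian.Ext.comp_zero]

theorem ev_right (hf : Function.Injective f) (hfg : Function.Exact f g) (hg : Function.Surjective g)
    (Y : Type) [AddCommGroup Y] [Module R Y]
    (n : ℕ) (hA : EV R n A Y) (hB : EV R (n+1) B Y) : EV R (n+1) C Y := by
  rw [ev_iff] at *
  intro x
  obtain ⟨y, hy⟩ := Abelian.Ext.contravariant_sequence_exact₃ (modCat_shortExact f g hf hfg hg)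
    (ModuleCat.of R Y) x (hB _) (add_comm 1 n)
  rw [← hy, hA y, Abelian.Ext.comp_zero]

theorem ev_left (hf : Function.Injective f) (hfg : Function.Exact f g) (hg : Function.Surjective g)
    (Y : Type) [AddCommGroup Y] [Module R Y]
    (n : ℕ) (hB : EV R n B Y) (hC : EV R (n+1) C Y) : EV R n A Y := by
  rw [ev_iff] at *
  intro x
  obtain ⟨y, hy⟩ := Abelian.Ext.contravariant_sequence_exact₁ (modCat_shortExact f g hf hfg hg)
    (ModuleCat.of R Y) x (add_comm 1 n) (hC _)
  rw [← hy, hB y, Abelian.Ext.comp_zero]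

theorem ev_extend (hf : Function.Injective f) (hfg : Function.Exact f g) (hg : Function.Surjective g)
    (Y : Type) [AddCommGroup Y] [Module R Y]
    (hC : EV R 1 C Y) (φ : A →ₗ[R] Y) : ∃ ψ : B →ₗ[R] Y, ψ ∘ₗ f = φ := by
  rw [ev_iff] at hC
  obtain ⟨y, hy⟩ := Abelian.Ext.contravariant_sequence_exact₁ (modCat_shortExact f g hf hfg hg)
    (ModuleCat.of R Y) (Abelian.Ext.mk₀ (ModuleCat.ofHom φ)) (add_comm 1 0) (hC _)
  obtain ⟨ψ, rfl⟩ := (Abelian.Ext.mk₀_bijective _ _).2 y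
  rw [Abelian.Ext.mk₀_comp_mk₀] at hy
  have := (Abelian.Ext.mk₀_bijective _ _).1 hy
  exact ⟨ψ.hom, congrArg ModuleCat.Hom.hom this⟩

theorem ev_of_extend (hf : Function.Injective f) (hfg : Function.Exact f g) (hg : Function.Surjective g)
    (Y : Type) [AddCommGroup Y] [Module R Y]
    (hB : EV R 1 B Y) (h : ∀ φ : A →ₗ[R] Y, ∃ ψ : B →ₗ[R] Y, ψ ∘ₗ f = φ) :
    EV R 1 C Y := by
  rw [ev_iff] at *
  intro x
  obtain ⟨y, hy⟩ := Abelian.Ext.contravariant_sequence_exact₃ (modCat_shortExact f g hf hfg hg)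
    (ModuleCat.of R Y) x (hB _) (add_comm 1 0)
  obtain ⟨φ, rfl⟩ := (Abelian.Ext.mk₀_bijective _ _).2 y
  obtain ⟨ψ, hψ⟩ := h φ.hom
  have : φ = ModuleCat.ofHom f ≫ ModuleCat.ofHom ψ := by ext x; exact (congrArg (fun k => k x) hψ).symm
  rw [this, ← Abelian.Ext.mk₀_comp_mk₀] at hy
  rw [← hy]
  exact (modCat_shortExact f g hf hfg hg).extClass_comp_assoc _

theorem ev_cov (hf : Function.Injective f) (hfg : Function.Exact f g) (hg : Function.Surjective g)
    (Y : Type) [AddCommGroup Y] [Module R Y]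
    (n : ℕ) (hC : EV R n Y C) (hB : EV R (n+1) Y B) : EV R (n+1) Y A := by
  rw [ev_iff] at *
  intro x
  obtain ⟨y, hy⟩ := Abelian.Ext.covariant_sequence_exact₁ (ModuleCat.of R Y)
    (modCat_shortExact f g hf hfg hg)
    x (hB _) rfl
  rw [← hy, hC y, Abelian.Ext.zero_comp]

theorem ev_covmid (hf : Function.Injective f) (hfg : Function.Exact f g) (hg : Function.Surjective g)
    (Y : Type) [AddCommGroup Y] [Module R Y]
    (n : ℕ) (hA : EV R n Y A) (hC : EV R n Y C) : EV R n Y B := by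
  rw [ev_iff] at *
  intro x
  obtain ⟨y, hy⟩ := Abelian.Ext.covariant_sequence_exact₂ (ModuleCat.of R Y)
    (modCat_shortExact f g hf hfg hg)
    x (hC _)
  rw [← hy, hA y, Abelian.Ext.zero_comp]

theorem ev_cov_zero (hf : Function.Injective f) (Y : Type) [AddCommGroup Y] [Module R Y]
    (hB : EV R 0 Y B) : EV R 0 Y A := by
  rw [ev_iff] at *
  intro x
  have := (ModuleCat.mono_iff_injective (ModuleCat.ofHom f)).2 hf
  exact Abelian.Ext.postcomp_mk₀_injective_of_mono (ModuleCat.of R Y) (ModuleCat.ofHom f)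
    ((hB _).trans (hB _).symm)

end LES

theorem ev_retract {A B Y : Type} [AddCommGroup A] [AddCommGroup B] [AddCommGroup Y]
    [Module R A] [Module R B] [Module R Y] (i : A →ₗ[R] B) (r : B →ₗ[R] A) (h : r ∘ₗ i = LinearMap.id)
    (n : ℕ) (hB : EV R n Y B) : EV R n Y A := by
  rw [ev_iff] at *
  intro x
  have h2 : ModuleCat.ofHom i ≫ ModuleCat.ofHom r = 𝟙 (ModuleCat.of R A) := by
    ext x; exact congrArg (fun k => k x) h
  have h3 := Abelian.Ext.comp_assoc_of_third_deg_zero x (Abelian.Ext.mk₀ (ModuleCat.ofHom i))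
    (Abelian.Ext.mk₀ (ModuleCat.ofHom r)) (add_zero n)
  rw [Abelian.Ext.mk₀_comp_mk₀, h2, Abelian.Ext.comp_mk₀_id,
    hB (x.comp (Abelian.Ext.mk₀ (ModuleCat.ofHom i)) (add_zero n)), Abelian.Ext.zero_comp] at h3
  exact h3.symm

theorem ev_congr {A B Y : Type} [AddCommGroup A] [AddCommGroup B] [AddCommGroup Y]
    [Module R A] [Module R B] [Module R Y] (e : A ≃ₗ[R] B)
    (n : ℕ) (hB : EV R n B Y) : EV R n A Y := by
  rw [ev_iff] at *
  intro x
  have h3 := Abelian.Ext.mk₀_comp_mk₀_assoc (ModuleCat.ofHom e.toLinearMap) (ModuleCat.ofHom e.symm.toLinearMap) x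
  have h2 : ModuleCat.ofHom e.toLinearMap ≫ ModuleCat.ofHom e.symm.toLinearMap = 𝟙 (ModuleCat.of R A) := by
    ext x; exact e.symm_apply_apply x
  rw [h2, hB ((Abelian.Ext.mk₀ (ModuleCat.ofHom e.symm.toLinearMap)).comp x (zero_add n)),
    Abelian.Ext.comp_zero, Abelian.Ext.mk₀_id_comp] at h3
  exact h3.symm

theorem ev_subsingleton {A Y : Type} [AddCommGroup A] [AddCommGroup Y]
    [Module R A] [Module R Y] [Subsingleton A]
    (n : ℕ) : EV R n A Y := by
  rw [ev_iff]
  intro x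
  have : 𝟙 (ModuleCat.of R A) = 0 := by ext x; exact Subsingleton.elim _ _
  rw [← Abelian.Ext.mk₀_id_comp x, this, Abelian.Ext.mk₀_zero, Abelian.Ext.zero_comp]

end ExtPart


section InjDim

variable {R : Type} [CommRing R] [IsNoetherianRing R] [IsLocalRing R]

theorem ev_nak {A C Y : Type} [AddCommGroup A] [AddCommGroup C] [AddCommGroup Y]
    [Module R A] [Module R C] [Module R Y] [Module.Finite R A] [Module.Finite R Y]
    (x : R) (hx : x ∈ maximalIdeal R) {f : A →ₗ[R] A} (hfx : f = x • LinearMap.id) {g : A →ₗ[R] C}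
    (hf : Function.Injective f) (hfg : Function.Exact f g) (hg : Function.Surjective g)
    (n : ℕ) (hC : EV R (n+1) C Y) : EV R n A Y := by
  have hfin : Module.Finite R (Abelian.Ext (ModuleCat.of R A) (ModuleCat.of R Y) n) := by
    have h1 : Module.Finite R (ModuleCat.of R A) := inferInstanceAs (Module.Finite R A)
    have h2 : Module.Finite R (ModuleCat.of R Y) := inferInstanceAs (Module.Finite R Y)
    infer_instance
  have hsurj : ∀ y : Abelian.Ext (ModuleCat.of R A) (ModuleCat.of R Y) n, ∃ z, y = x • z := by
    rw [ev_iff] at hC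
    intro y
    obtain ⟨z, hz⟩ := Abelian.Ext.contravariant_sequence_exact₁ (modCat_shortExact f g hf hfg hg)
      (ModuleCat.of R Y) y (add_comm 1 n) (hC _)
    refine ⟨z, ?_⟩
    rw [← hz]
    change (Abelian.Ext.mk₀ (ModuleCat.ofHom f)).comp z (zero_add n) = _
    have : ModuleCat.ofHom f = x • 𝟙 (ModuleCat.of R A) := by
      subst hfx
      rfl
    rw [this, Abelian.Ext.mk₀_smul, Abelian.Ext.smul_comp, Abelian.Ext.mk₀_id_comp]
  have htop : (⊤ : Submodule R (Abelian.Ext (ModuleCat.of R A) (ModuleCat.of R Y) n)) = ⊥ := by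
    refine Submodule.eq_bot_of_le_smul_of_le_jacobson_bot (maximalIdeal R) ⊤ hfin.1 ?_
      (IsLocalRing.maximalIdeal_le_jacobson _)
    intro y _
    obtain ⟨z, rfl⟩ := hsurj y
    exact Submodule.smul_mem_smul hx trivial
  rw [ev_iff]
  intro y
  have : y ∈ (⊤ : Submodule R (Abelian.Ext (ModuleCat.of R A) (ModuleCat.of R Y) n)) := trivial
  rw [htop] at this
  exact this

theorem injdim_aux (d : ℕ) (hk : ∀ i, d < i → EV R i (R ⧸ maximalIdeal R) R) (I : Ideal R) :
    ∀ (N : Type) [AddCommGroup N] [Module R N] [Module.Finite R N],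
      (∀ a ∈ I, ∀ y : N, a • y = 0) → ∀ i, d < i → EV R i N R := by
  induction I using WellFoundedGT.induction with
  | ind I ih =>
    intro N _ _ _
    refine IsNoetherianRing.induction_on_isQuotientEquivQuotientPrime (A := R)
      (motive := fun N _ _ _ => (∀ a ∈ I, ∀ y : N, a • y = 0) → ∀ i, d < i → EV R i N R)
      (M := N) inferInstance ?_ ?_ ?_
    · intro N _ _ _ _ _ i _
      exact ev_subsingleton i
    · intro N _ _ _ p e h i hi
      refine ev_congr e i ?_
      have hIp : I ≤ p.asIdeal := by
        intro a ha
        have h1 := h a ha (e.symm (Ideal.Quotient.mk _ 1))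
        rw [← map_smul, LinearEquiv.map_eq_zero_iff] at h1
        have h2 : (Ideal.Quotient.mk p.asIdeal) (a * 1) = 0 := h1
        rw [mul_one] at h2
        exact Ideal.Quotient.eq_zero_iff_mem.1 h2
      rcases hIp.lt_or_eq with hlt | heq
      · refine ih p.asIdeal hlt (R ⧸ p.asIdeal) ?_ i hi
        intro a ha y
        obtain ⟨y, rfl⟩ := Ideal.Quotient.mk_surjective y
        change (Ideal.Quotient.mk p.asIdeal) (a * y) = 0
        exact Ideal.Quotient.eq_zero_iff_mem.2 (p.asIdeal.mul_mem_right _ ha)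
      · by_cases hm : p.asIdeal = maximalIdeal R
        · rw [hm]; exact hk i hi
        · have hle : p.asIdeal ≤ maximalIdeal R := IsLocalRing.le_maximalIdeal p.2.ne_top
          obtain ⟨x, hx, hxp⟩ := SetLike.exists_of_lt (lt_of_le_of_ne hle hm)
          let f : (R ⧸ p.asIdeal) →ₗ[R] (R ⧸ p.asIdeal) := x • LinearMap.id
          have hfa : ∀ y : R, f (Ideal.Quotient.mk _ y) = Ideal.Quotient.mk _ (x * y) := fun y => rfl
          have hfi : Function.Injective f := by
            rw [injective_iff_map_eq_zero]
            intro y hy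
            obtain ⟨y, rfl⟩ := Ideal.Quotient.mk_surjective y
            rw [hfa, Ideal.Quotient.eq_zero_iff_mem] at hy
            exact Ideal.Quotient.eq_zero_iff_mem.2 ((p.2.mem_or_mem hy).resolve_left hxp)
          refine ev_nak x hx (f := f) rfl (g := (LinearMap.range f).mkQ) hfi
            (LinearMap.exact_iff.2 (Submodule.ker_mkQ _)) (Submodule.mkQ_surjective _) i ?_
          refine ih (I ⊔ Ideal.span {x}) ?_ _ ?_ (i+1) (by omega)
          · refine lt_of_le_of_ne le_sup_left ?_
            intro h
            apply hxp
            rw [← heq, h]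
            exact Ideal.mem_sup_right (Ideal.mem_span_singleton_self x)
          · intro a ha y
            obtain ⟨y, rfl⟩ := Submodule.mkQ_surjective _ y
            obtain ⟨b, hb, c, hc, rfl⟩ := Submodule.mem_sup.1 ha
            obtain ⟨c, rfl⟩ := Ideal.mem_span_singleton'.1 hc
            obtain ⟨y, rfl⟩ := Ideal.Quotient.mk_surjective y
            rw [← map_smul, Submodule.mkQ_apply, Submodule.Quotient.mk_eq_zero]
            refine ⟨Ideal.Quotient.mk _ (c * y), ?_⟩
            rw [hfa]
            change _ = Ideal.Quotient.mk _ ((b + c * x) * y)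
            rw [Ideal.Quotient.mk_eq_mk_iff_sub_mem]
            have : x * (c * y) - (b + c * x) * y = b * (-y) := by ring
            rw [this]
            exact p.asIdeal.mul_mem_right _ (heq ▸ hb)
    · intro N1 _ _ _ N2 _ _ _ N3 _ _ _ f g hf hg hfg h1 h3 h i hi
      refine ev_mid hf hfg hg R i (h1 ?_ i hi) (h3 ?_ i hi)
      · intro a ha y
        apply hf
        rw [map_smul, h a ha, map_zero]
      · intro a ha y
        obtain ⟨y, rfl⟩ := hg y
        rw [← map_smul, h a ha, map_zero]

theorem injdim (d : ℕ) (hk : ∀ i, d < i → EV R i (R ⧸ maximalIdeal R) R)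
    (N : Type) [AddCommGroup N] [Module R N] [Module.Finite R N] (i : ℕ) (hi : d < i) :
    EV R i N R := by
  refine injdim_aux d hk ⊥ N ?_ i hi
  intro a ha y
  rw [Ideal.mem_bot.1 ha, zero_smul]

end InjDim


section GG

variable {R : Type} [CommRing R]

theorem ev_pi {Y : Type} [AddCommGroup Y] [Module R Y] (m n : ℕ) (h : EV R n Y R) :
    EV R n Y (Fin m → R) := by
  rw [ev_iff] at *
  intro x
  have h1 : 𝟙 (ModuleCat.of R (Fin m → R)) = ∑ j : Fin m,
      ModuleCat.ofHom (LinearMap.proj (R := R) (φ := fun _ : Fin m => R) j) ≫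
        ModuleCat.ofHom (LinearMap.single R (fun _ : Fin m => R) j) := by
    apply ModuleCat.hom_ext
    rw [ModuleCat.hom_sum]
    apply LinearMap.ext
    intro v
    rw [LinearMap.sum_apply]
    exact (Finset.univ_sum_single v).symm
  rw [← Abelian.Ext.comp_mk₀_id x, h1, Abelian.Ext.mk₀_sum, Abelian.Ext.comp_sum]
  refine Finset.sum_eq_zero fun j _ => ?_
  rw [← Abelian.Ext.mk₀_comp_mk₀, ← Abelian.Ext.comp_assoc_of_third_deg_zero]
  rw [h (x.comp (Abelian.Ext.mk₀ (ModuleCat.ofHom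
    (LinearMap.proj (R := R) (φ := fun _ : Fin m => R) j))) (add_zero n)), Abelian.Ext.zero_comp]

/-- all higher Ext into `R` vanish -/
def GG (R : Type) [CommRing R] (K : Type) [AddCommGroup K] [Module R K] : Prop :=
  ∀ i, 1 ≤ i → EV R i K R

theorem factor_surj {A B C : Type} [AddCommGroup A] [AddCommGroup B] [AddCommGroup C]
    [Module R A] [Module R B] [Module R C] {g : A →ₗ[R] B} (hg : Function.Surjective g)
    {φ : A →ₗ[R] C} (h : LinearMap.ker g ≤ LinearMap.ker φ) : ∃ ψ : B →ₗ[R] C, ψ ∘ₗ g = φ := by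
  refine ⟨(Submodule.liftQ _ φ h) ∘ₗ (g.quotKerEquivOfSurjective hg).symm.toLinearMap, ?_⟩
  ext a
  have : (g.quotKerEquivOfSurjective hg).symm (g a) = (LinearMap.ker g).mkQ a := by
    rw [LinearEquiv.symm_apply_eq]
    rfl
  simp [this]

variable [IsNoetherianRing R]

theorem exists_syz (N : Type) [AddCommGroup N] [Module R N] [Module.Finite R N] :
    ∃ (m : ℕ) (A : Type) (_ : AddCommGroup A) (_ : Module R A) (_ : Module.Finite R A)
      (f : A →ₗ[R] (Fin m → R)) (g : (Fin m → R) →ₗ[R] N),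
      Function.Injective f ∧ Function.Exact f g ∧ Function.Surjective g := by
  obtain ⟨m, g, hg⟩ := Module.Finite.exists_fin' R N
  exact ⟨m, LinearMap.ker g, inferInstance, inferInstance, inferInstance,
    (LinearMap.ker g).subtype, g, Subtype.val_injective, LinearMap.exact_subtype_ker_map g, hg⟩

theorem gg_syz {A B C : Type} [AddCommGroup A] [AddCommGroup B] [AddCommGroup C]
    [Module R A] [Module R B] [Module R C] [Module.Projective R B] {f : A →ₗ[R] B} {g : B →ₗ[R] C}
    (hf : Function.Injective f) (hfg : Function.Exact f g) (hg : Function.Surjective g)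
    (hC : GG R C) : GG R A := by
  intro i hi
  obtain ⟨n, rfl⟩ := Nat.exists_eq_add_of_le' hi
  exact ev_left hf hfg hg R (n+1) (ev_proj R n) (hC _ (by omega))

theorem dual_seq {A B C : Type} [AddCommGroup A] [AddCommGroup B] [AddCommGroup C]
    [Module R A] [Module R B] [Module R C] {f : A →ₗ[R] B} {g : B →ₗ[R] C}
    (hf : Function.Injective f) (hfg : Function.Exact f g) (hg : Function.Surjective g)
    (hC : EV R 1 C R) :
    Function.Injective (g.dualMap) ∧ Function.Exact g.dualMap f.dualMap ∧
      Function.Surjective f.dualMap := by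
  refine ⟨LinearMap.dualMap_injective_of_surjective hg, ?_, ?_⟩
  · intro φ
    constructor
    · intro h
      have hle : LinearMap.ker g ≤ LinearMap.ker φ := by
        intro b hb
        obtain ⟨a, rfl⟩ := (hfg b).1 hb
        exact congrArg (fun k => k a) h
      obtain ⟨ψ, hψ⟩ := factor_surj hg hle
      exact ⟨ψ, hψ⟩
    · rintro ⟨ψ, rfl⟩
      ext a
      change ψ (g (f a)) = 0
      rw [hfg.apply_apply_eq_zero, map_zero]
  · intro φ
    exact ev_extend hf hfg hg R hC φ

theorem dual_ev (d : ℕ) (hinj : ∀ (N : Type) [AddCommGroup N] [Module R N] [Module.Finite R N],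
      ∀ i, d < i → EV R i N R) (n : ℕ) :
    ∀ j, 1 ≤ j → d < j + n → ∀ (K : Type) [AddCommGroup K] [Module R K] [Module.Finite R K],
      GG R K → EV R j (Module.Dual R K) R := by
  induction n with
  | zero =>
    intro j _ hj K _ _ _ _
    exact hinj _ j hj
  | succ n ih =>
    intro j hj hjn K _ _ _ hK
    obtain ⟨m, A, _, _, _, f, g, hf, hfg, hg⟩ := exists_syz (R := R) K
    obtain ⟨h1, h2, h3⟩ := dual_seq hf hfg hg (hK 1 le_rfl)
    obtain ⟨l, rfl⟩ := Nat.exists_eq_add_of_le' hj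
    exact ev_left h1 h2 h3 R (l+1) (ev_proj R l)
      (ih (l+1+1) (by omega) (by omega) A (gg_syz hf hfg hg hK))

theorem eval_surj (d : ℕ) (hinj : ∀ (N : Type) [AddCommGroup N] [Module R N] [Module.Finite R N],
      ∀ i, d < i → EV R i N R) (K : Type) [AddCommGroup K] [Module R K] [Module.Finite R K]
      (hK : GG R K) (ψ : Module.Dual R (Module.Dual R K)) :
      ∃ x : K, ∀ φ : Module.Dual R K, ψ φ = φ x := by
  obtain ⟨m, A, _, _, _, f, g, hf, hfg, hg⟩ := exists_syz (R := R) K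
  obtain ⟨h1, h2, h3⟩ := dual_seq hf hfg hg (hK 1 le_rfl)
  obtain ⟨χ, hχ⟩ := ev_extend h1 h2 h3 R
    (dual_ev d hinj d 1 le_rfl (by omega) A (gg_syz hf hfg hg hK)) ψ
  obtain ⟨v, hv⟩ := (Module.bijective_dual_eval R (Fin m → R)).2 χ
  refine ⟨g v, fun φ => ?_⟩
  rw [← hχ, ← hv]
  rfl

theorem eval_inj (d : ℕ) (hinj : ∀ (N : Type) [AddCommGroup N] [Module R N] [Module.Finite R N],
      ∀ i, d < i → EV R i N R) (K : Type) [AddCommGroup K] [Module R K] [Module.Finite R K]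
      (hK : GG R K) (x : K) (hx : ∀ φ : Module.Dual R K, φ x = 0) : x = 0 := by
  obtain ⟨m, A, _, _, _, f, g, hf, hfg, hg⟩ := exists_syz (R := R) K
  obtain ⟨h1, h2, h3⟩ := dual_seq hf hfg hg (hK 1 le_rfl)
  obtain ⟨v, rfl⟩ := hg x
  -- the evaluation at v factors through the dual of `A`
  have hle : LinearMap.ker f.dualMap ≤ LinearMap.ker (Module.Dual.eval R (Fin m → R) v) := by
    intro φ hφ
    obtain ⟨φ', rfl⟩ := (h2 φ).1 hφ
    exact hx φ'
  obtain ⟨ψ, hψ⟩ : ∃ ψ : Module.Dual R (Module.Dual R A),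
      ψ ∘ₗ f.dualMap = Module.Dual.eval R (Fin m → R) v := by
    exact factor_surj h3 hle
  obtain ⟨z, hz⟩ := eval_surj d hinj A (gg_syz hf hfg hg hK) ψ
  have : f z = v := by
    apply (Module.bijective_dual_eval R (Fin m → R)).1
    rw [← hψ]
    ext φ
    exact (hz (f.dualMap φ)).symm
  rw [← this]
  exact hfg.apply_apply_eq_zero z

theorem exists_cosyz (d : ℕ) (hinj : ∀ (N : Type) [AddCommGroup N] [Module R N] [Module.Finite R N],
      ∀ i, d < i → EV R i N R) (K : Type) [AddCommGroup K] [Module R K] [Module.Finite R K]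
      (hK : GG R K) : ∃ (m : ℕ) (X : Type) (_ : AddCommGroup X) (_ : Module R X)
      (_ : Module.Finite R X)
      (f : K →ₗ[R] (Fin m → R)) (g : (Fin m → R) →ₗ[R] X),
      Function.Injective f ∧ Function.Exact f g ∧ Function.Surjective g ∧ GG R X ∧
      (∀ φ : K →ₗ[R] R, ∃ ψ : (Fin m → R) →ₗ[R] R, ψ ∘ₗ f = φ) := by
  obtain ⟨m, s, hs⟩ := Module.Finite.exists_fin (R := R) (M := Module.Dual R K)
  let f : K →ₗ[R] (Fin m → R) := LinearMap.pi s
  have hext : ∀ φ : K →ₗ[R] R, ∃ ψ : (Fin m → R) →ₗ[R] R, ψ ∘ₗ f = φ := by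
    intro φ
    have : φ ∈ Submodule.span R (Set.range s) := hs ▸ trivial
    obtain ⟨c, rfl⟩ := (Submodule.mem_span_range_iff_exists_fun R).1 this
    refine ⟨∑ i, c i • LinearMap.proj i, ?_⟩
    ext x
    simp [f]
  have hinjf : Function.Injective f := by
    rw [injective_iff_map_eq_zero]
    intro x hx
    refine eval_inj d hinj K hK x fun φ => ?_
    obtain ⟨ψ, rfl⟩ := hext φ
    rw [LinearMap.comp_apply, hx, map_zero]
  have hfg : Function.Exact f (LinearMap.range f).mkQ := LinearMap.exact_iff.2 (Submodule.ker_mkQ _)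
  have hg : Function.Surjective (LinearMap.range f).mkQ := Submodule.mkQ_surjective _
  refine ⟨m, (Fin m → R) ⧸ LinearMap.range f, inferInstance, inferInstance, inferInstance, f,
    (LinearMap.range f).mkQ, hinjf, hfg, hg, ?_, hext⟩
  intro i hi
  obtain ⟨n, rfl⟩ := Nat.exists_eq_add_of_le' hi
  cases n with
  | zero => exact ev_of_extend hinjf hfg hg R (ev_proj R 0) hext
  | succ n => exact ev_right hinjf hfg hg R (n+1) (hK _ (by omega)) (ev_proj R _)

theorem gg_depth (d : ℕ) (hinj : ∀ (N : Type) [AddCommGroup N] [Module R N] [Module.Finite R N],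
      ∀ i, d < i → EV R i N R) (k : Type) [AddCommGroup k] [Module R k]
      (hk : ∀ i, i < d → EV R i k R) (i : ℕ) : i < d →
      ∀ (K : Type) [AddCommGroup K] [Module R K] [Module.Finite R K],
      GG R K → EV R i k K := by
  induction i with
  | zero =>
    intro hi K _ _ _ hK
    obtain ⟨m, X, _, _, _, f, g, hf, hfg, hg, hX, -⟩ := exists_cosyz d hinj K hK
    exact ev_cov_zero hf k (ev_pi m 0 (hk 0 hi))
  | succ i ih =>
    intro hi K _ _ _ hK
    obtain ⟨m, X, _, _, _, f, g, hf, hfg, hg, hX, -⟩ := exists_cosyz d hinj K hK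
    exact ev_cov hf hfg hg k i (ih (by omega) X hX) (ev_pi m _ (hk _ hi))

end GG


section Rank

/-- finite free of given rank -/
def FR (A : Type) [CommRing A] (N : Type) [AddCommGroup N] [Module A N] (r : ℕ) : Prop :=
  Module.Free A N ∧ Module.Finite A N ∧ Module.finrank A N = r

section Loc

variable {A : Type} [CommRing A] [IsLocalRing A]

theorem fr_iff (N : Type) [AddCommGroup N] [Module A N] (r : ℕ) :
    FR A N r ↔ Nonempty (N ≃ₗ[A] (Fin r → A)) := by
  constructor
  · rintro ⟨h1, h2, h3⟩
    exact ⟨LinearEquiv.ofFinrankEq _ _ (by rw [h3, Module.finrank_fin_fun])⟩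
  · rintro ⟨e⟩
    exact ⟨Module.Free.of_equiv e.symm, Module.Finite.equiv e.symm,
      by rw [e.finrank_eq, Module.finrank_fin_fun]⟩

variable {N₁ N₂ N₃ : Type} [AddCommGroup N₁] [AddCommGroup N₂] [AddCommGroup N₃]
    [Module A N₁] [Module A N₂] [Module A N₃] {f : N₁ →ₗ[A] N₂} {g : N₂ →ₗ[A] N₃}

theorem fr_summand (e : N₂ ≃ₗ[A] N₁ × N₃) {m r : ℕ} (h2 : FR A N₂ m) (h3 : FR A N₃ r) :
    FR A N₁ (m - r) := by
  obtain ⟨h2f, h2fin, h2r⟩ := h2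
  obtain ⟨h3f, h3fin, h3r⟩ := h3
  have hfin : Module.Finite A N₁ :=
    Module.Finite.of_surjective (LinearMap.fst A N₁ N₃ ∘ₗ e.toLinearMap)
      (Prod.fst_surjective.comp e.surjective)
  have hproj : Module.Projective A N₁ :=
    Module.Projective.of_split (e.symm.toLinearMap ∘ₗ LinearMap.inl A N₁ N₃)
      (LinearMap.fst A N₁ N₃ ∘ₗ e.toLinearMap) (by ext x; simp)
  have hfree : Module.Free A N₁ := Module.free_of_flat_of_isLocalRing
  refine ⟨hfree, hfin, ?_⟩
  have := e.finrank_eq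
  rw [Module.finrank_prod, h2r, h3r] at this
  omega

theorem fr_prod (e : N₂ ≃ₗ[A] N₁ × N₃) {m r : ℕ} (h2 : FR A N₁ m) (h3 : FR A N₃ r) :
    FR A N₂ (m + r) := by
  obtain ⟨h2f, h2fin, h2r⟩ := h2
  obtain ⟨h3f, h3fin, h3r⟩ := h3
  refine ⟨Module.Free.of_equiv e.symm, Module.Finite.equiv e.symm, ?_⟩
  rw [e.finrank_eq, Module.finrank_prod, h2r, h3r]

theorem ses_split_proj (hf : Function.Injective f) (hfg : Function.Exact f g)
    (hg : Function.Surjective g) [Module.Projective A N₃] : Nonempty (N₂ ≃ₗ[A] N₁ × N₃) := by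
  obtain ⟨l, hl⟩ := Module.projective_lifting_property g LinearMap.id hg
  exact ⟨(hfg.splitSurjectiveEquiv hf ⟨l, hl⟩).1⟩

theorem ses_split_retr (hf : Function.Injective f) (hfg : Function.Exact f g)
    (hg : Function.Surjective g) (l : N₂ →ₗ[A] N₁) (hl : l ∘ₗ f = LinearMap.id) :
    Nonempty (N₂ ≃ₗ[A] N₁ × N₃) := by
  exact ⟨(hfg.splitInjectiveEquiv hg ⟨l, hl⟩).1⟩

end Loc

variable {R : Type} [CommRing R]

theorem hasRank_iff (C : Type) [AddCommGroup C] [Module R C] (r : ℕ) :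
    HasRankN R C r ↔ ∀ (p : Ideal R) (_ : p.IsPrime), p ∈ associatedPrimes R R →
      FR (Localization.AtPrime p) (LocalizedModule p.primeCompl C) r := by
  unfold HasRankN
  refine forall_congr' fun p => forall_congr' fun hp => forall_congr' fun _ => ?_
  rw [fr_iff]

theorem fr_loc_free (p : Ideal R) [p.IsPrime] (F : Type) [AddCommGroup F] [Module R F]
    [Module.Free R F] [Module.Finite R F] [Nontrivial R] :
    FR (Localization.AtPrime p) (LocalizedModule p.primeCompl F) (Module.finrank R F) := by
  have h1 : Module.Free (Localization.AtPrime p) (LocalizedModule p.primeCompl F) :=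
    Module.free_of_isLocalizedModule p.primeCompl (LocalizedModule.mkLinearMap p.primeCompl F)
  refine ⟨h1, inferInstance, ?_⟩
  exact Module.finrank_of_isLocalizedModule_of_free (Localization.AtPrime p) p.primeCompl
    (LocalizedModule.mkLinearMap p.primeCompl F)

section SES

variable {A B C : Type} [AddCommGroup A] [AddCommGroup B] [AddCommGroup C]
    [Module R A] [Module R B] [Module R C] {f : A →ₗ[R] B} {g : B →ₗ[R] C}

theorem loc_ses (hf : Function.Injective f) (hfg : Function.Exact f g) (hg : Function.Surjective g)
    (S : Submonoid R) : Function.Injective (LocalizedModule.map S f) ∧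
    Function.Exact (LocalizedModule.map S f) (LocalizedModule.map S g) ∧
    Function.Surjective (LocalizedModule.map S g) :=
  ⟨LocalizedModule.map_injective S f hf, LocalizedModule.map_exact S f g hfg,
    LocalizedModule.map_surjective S g hg⟩

theorem rank_syz (hf : Function.Injective f) (hfg : Function.Exact f g) (hg : Function.Surjective g)
    [Module.Free R B] [Module.Finite R B] [Nontrivial R]
    (hC : ∃ r, HasRankN R C r) : ∃ r, HasRankN R A r := by
  obtain ⟨r, hr⟩ := hC
  refine ⟨Module.finrank R B - r, ?_⟩
  rw [hasRank_iff] at *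
  intro p hp hpa
  obtain ⟨h1, h2, h3⟩ := loc_ses hf hfg hg p.primeCompl
  have := (hr p hp hpa).1
  obtain ⟨e⟩ := ses_split_proj h1 h2 h3
  exact fr_summand e (fr_loc_free p B) (hr p hp hpa)

theorem rank_ext (hf : Function.Injective f) (hfg : Function.Exact f g) (hg : Function.Surjective g)
    [Module.Free R C] [Module.Finite R C] [Nontrivial R]
    (hC : ∃ r, HasRankN R A r) : ∃ r, HasRankN R B r := by
  obtain ⟨r, hr⟩ := hC
  refine ⟨r + Module.finrank R C, ?_⟩
  rw [hasRank_iff] at *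
  intro p hp hpa
  obtain ⟨h1, h2, h3⟩ := loc_ses hf hfg hg p.primeCompl
  have := (fr_loc_free p C).1
  obtain ⟨e⟩ := ses_split_proj h1 h2 h3
  exact fr_prod e (hr p hp hpa) (fr_loc_free p C)

theorem loc_extend [Module.FinitePresentation R A]
    (hext : ∀ φ : A →ₗ[R] R, ∃ ψ : B →ₗ[R] R, ψ ∘ₗ f = φ) (S : Submonoid R)
    (φ : LocalizedModule S A →ₗ[Localization S] Localization S) :
    ∃ ψ : LocalizedModule S B →ₗ[Localization S] Localization S,
      ψ ∘ₗ LocalizedModule.map S f = φ := by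
  obtain ⟨h, s, hs⟩ := Module.FinitePresentation.exists_lift_of_isLocalizedModule S
    (Algebra.linearMap R (Localization S))
    ((φ.restrictScalars R) ∘ₗ LocalizedModule.mkLinearMap S A)
  obtain ⟨ψ, rfl⟩ := hext h
  let ψ' : LocalizedModule S B →ₗ[Localization S] Localization S :=
    (IsLocalizedModule.map S (LocalizedModule.mkLinearMap S B)
      (Algebra.linearMap R (Localization S)) ψ).extendScalarsOfIsLocalization S _
  refine ⟨Localization.mk 1 s • ψ', ?_⟩
  have key : ∀ a : A, ψ' (LocalizedModule.map S f (LocalizedModule.mkLinearMap S A a)) =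
      (s : R) • φ (LocalizedModule.mkLinearMap S A a) := by
    intro a
    have h1 : LocalizedModule.map S f (LocalizedModule.mkLinearMap S A a) =
      LocalizedModule.mkLinearMap S B (f a) := LocalizedModule.map_mk S f a 1
    rw [h1]
    change (IsLocalizedModule.map S (LocalizedModule.mkLinearMap S B)
      (Algebra.linearMap R (Localization S)) ψ) (LocalizedModule.mkLinearMap S B (f a)) = _
    rw [IsLocalizedModule.map_apply]
    exact congrArg (fun k => k a) hs
  have key2 : (((Localization.mk 1 s • ψ') ∘ₗ LocalizedModule.map S f).restrictScalars R) =
      φ.restrictScalars R := by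
    refine IsLocalizedModule.ext S (LocalizedModule.mkLinearMap S A)
      (IsLocalizedModule.map_units (Algebra.linearMap R (Localization S))) ?_
    ext a
    change Localization.mk 1 s • ψ' (LocalizedModule.map S f (LocalizedModule.mkLinearMap S A a))
      = φ (LocalizedModule.mkLinearMap S A a)
    rw [key, ← algebraMap_smul (Localization S) (s : R), smul_smul]
    have : Localization.mk 1 s * algebraMap R (Localization S) (s : R) = 1 := by
      rw [← Localization.mk_one_eq_algebraMap, Localization.mk_mul, one_mul, mul_one]
      exact Localization.mk_self s
    rw [this, one_smul]
  ext a
  exact congrArg (fun k => k a) key2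

theorem rank_cosyz (hf : Function.Injective f) (hfg : Function.Exact f g) (hg : Function.Surjective g)
    [IsNoetherianRing R] [Module.Finite R A]
    (hext : ∀ φ : A →ₗ[R] R, ∃ ψ : B →ₗ[R] R, ψ ∘ₗ f = φ)
    [Module.Free R B] [Module.Finite R B] [Nontrivial R]
    (hC : ∃ r, HasRankN R A r) : ∃ r, HasRankN R C r := by
  obtain ⟨r, hr⟩ := hC
  refine ⟨Module.finrank R B - r, ?_⟩
  rw [hasRank_iff]
  intro p hp hpa
  obtain ⟨h1, h2, h3⟩ := loc_ses hf hfg hg p.primeCompl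
  obtain ⟨e⟩ := hr p hp hpa
  have : Module.FinitePresentation R A := Module.finitePresentation_of_finite R A
  choose ψ hψ using fun i : Fin r => loc_extend hext p.primeCompl (LinearMap.proj i ∘ₗ e.toLinearMap)
  obtain ⟨e'⟩ := ses_split_retr h1 h2 h3 (e.symm.toLinearMap ∘ₗ LinearMap.pi ψ) (by
    rw [LinearMap.comp_assoc]
    have : LinearMap.pi ψ ∘ₗ LocalizedModule.map p.primeCompl f = e.toLinearMap := by
      apply LinearMap.ext
      intro x
      funext i
      exact congrArg (fun k => k x) (hψ i)
    rw [this]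
    ext x
    exact e.symm_apply_apply x)
  exact fr_summand (e'.trans (LinearEquiv.prodComm _ _ _)) (fr_loc_free p B) ((fr_iff _ _).2 ⟨e⟩)

end SES

end Rank


section Embed

variable {R : Type} [CommRing R] [IsNoetherianRing R]

theorem notMem_ass {p : Ideal R} (hp : p ∈ associatedPrimes R R) {a : R}
    (ha : a ∈ nonZeroDivisors R) : a ∉ p := by
  intro h
  have : a ∈ (nonZeroDivisors R : Set R)ᶜ := by
    rw [← biUnion_associatedPrimes_eq_compl_nonZeroDivisors]
    exact Set.mem_biUnion hp h
  exact this ha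

theorem exists_nzd (I : Ideal R) (h : ∀ p ∈ associatedPrimes R R, ∃ t ∈ I, t ∉ p) :
    ∃ a ∈ I, a ∈ nonZeroDivisors R := by
  by_contra hcon
  push Not at hcon
  obtain ⟨p, hp, hle⟩ :=
    (I.subset_union_prime_finite (associatedPrimes.finite R R) (f := id) 0 0 fun _ h _ _ ↦ h.1).1
      (by
        simp_rw [id, biUnion_associatedPrimes_eq_compl_nonZeroDivisors]
        exact fun x hx h ↦ hcon x hx h)
  obtain ⟨t, ht, htp⟩ := h p hp
  exact htp (hle ht)

theorem torsion_rank (C : Type) [AddCommGroup C] [Module R C] (hC : Module.IsTorsion R C) :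
    HasRankN R C 0 := by
  intro p hp hpa
  have : Subsingleton (LocalizedModule p.primeCompl C) := by
    refine ⟨fun x y => ?_⟩
    suffices H : ∀ x : LocalizedModule p.primeCompl C, x = 0 by rw [H x, H y]
    intro x
    induction x using LocalizedModule.induction_on with
    | h m s =>
      obtain ⟨a, ha⟩ := @hC m
      rw [← LocalizedModule.zero_mk s, LocalizedModule.mk_eq]
      refine ⟨⟨a.1, notMem_ass hpa a.2⟩, ?_⟩
      rw [smul_comm]
      have h1 : (a : R) • m = 0 := ha
      change s • ((a : R) • m) = (a : R) • s • (0 : C)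
      rw [h1]; simp
  exact ⟨LinearEquiv.ofSubsingleton _ _⟩

/-- `h` is surjective after localizing at `p`. -/
def Gen {B X : Type} [AddCommGroup X] [Module R X] [AddCommGroup B] [Module R B]
    (p : Ideal R) (h : B →ₗ[R] X) : Prop :=
  ∀ x : X, ∃ t, t ∉ p ∧ ∃ c, h c = t • x

variable {X : Type} [AddCommGroup X] [Module R X]

theorem exists_gen {s : ℕ} (p : Ideal R) [p.IsPrime]
    (e : LocalizedModule p.primeCompl X ≃ₗ[Localization.AtPrime p]
      (Fin s → Localization.AtPrime p)) : ∃ h : (Fin s → R) →ₗ[R] X, Gen p h := by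
  let ι : (Fin s → R) →ₗ[R] (Fin s → Localization.AtPrime p) :=
    LinearMap.pi fun i => Algebra.linearMap R (Localization.AtPrime p) ∘ₗ LinearMap.proj i
  have : Module.FinitePresentation R (Fin s → R) := Module.finitePresentation_of_finite R _
  obtain ⟨h, t, ht⟩ := Module.FinitePresentation.exists_lift_of_isLocalizedModule p.primeCompl
    (LocalizedModule.mkLinearMap p.primeCompl X)
    ((e.symm.toLinearMap.restrictScalars R) ∘ₗ ι)
  refine ⟨h, fun x => ?_⟩
  obtain ⟨u, hu⟩ := IsLocalization.exist_integer_multiples_of_finite p.primeCompl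
    (e (LocalizedModule.mkLinearMap p.primeCompl X x))
  choose b hb using hu
  have h1 : ι b = (u : R) • e (LocalizedModule.mkLinearMap p.primeCompl X x) := by
    funext i
    exact hb i
  have h2 : LocalizedModule.mkLinearMap p.primeCompl X (h b) =
      LocalizedModule.mkLinearMap p.primeCompl X (((t * u : p.primeCompl) : R) • x) := by
    have h3 : LocalizedModule.mkLinearMap p.primeCompl X (h b) = (t : R) • e.symm (ι b) :=
      congrArg (fun k => k b) ht
    rw [h3, h1, map_smul (LocalizedModule.mkLinearMap p.primeCompl X)]
    have h4 : e.symm ((u : R) • e (LocalizedModule.mkLinearMap p.primeCompl X x)) =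
        (u : R) • LocalizedModule.mkLinearMap p.primeCompl X x := by
      rw [← algebraMap_smul (Localization.AtPrime p) (u : R), map_smul, e.symm_apply_apply,
        algebraMap_smul]
    rw [h4, smul_smul]
    rfl
  obtain ⟨w, hw⟩ := (IsLocalizedModule.eq_iff_exists p.primeCompl
    (LocalizedModule.mkLinearMap p.primeCompl X)).1 h2
  refine ⟨((w * (t * u) : p.primeCompl) : R), (w * (t * u)).2, (w : R) • b, ?_⟩
  rw [map_smul]
  have h5 : (w : R) • h b = (w : R) • ((t * u : p.primeCompl) : R) • x := hw
  rw [h5, smul_smul]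
  rfl

/-- Nakayama step. -/
theorem gen_nak [Module.Finite R X] {B : Type} [AddCommGroup B] [Module R B] (p : Ideal R)
    [hp : p.IsPrime] (h h' : B →ₗ[R] X) (a : R) (ha : a ∉ p) (hgen : Gen p h)
    (hh : ∀ c, h' c - a • h c ∈ p • (⊤ : Submodule R X)) : Gen p h' := by
  let Y := X ⧸ LinearMap.range h'
  let π : X →ₗ[R] Y := (LinearMap.range h').mkQ
  have hπ : Function.Surjective π := Submodule.mkQ_surjective _
  have key : ∀ y : Y, ∃ t, t ∉ p ∧ t • y ∈ p • (⊤ : Submodule R Y) := by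
    intro y
    obtain ⟨x, rfl⟩ := hπ y
    obtain ⟨t, ht, c, hc⟩ := hgen x
    refine ⟨a * t, fun hmem => (hp.mem_or_mem hmem).elim ha ht, ?_⟩
    have h1 : (a * t) • π x = π (-(h' c - a • h c)) := by
      rw [neg_sub, map_sub]
      have : π (h' c) = 0 := (Submodule.Quotient.mk_eq_zero _).2 ⟨c, rfl⟩
      rw [this, sub_zero, hc, mul_smul, map_smul, map_smul]
    rw [h1, map_neg]
    refine neg_mem ?_
    have h2 : Submodule.map π (p • (⊤ : Submodule R X)) ≤ p • (⊤ : Submodule R Y) := by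
      rw [Submodule.map_smul'']
      exact Submodule.smul_mono le_rfl le_top
    exact h2 ⟨_, hh c, rfl⟩
  have htop : (⊤ : Submodule (Localization.AtPrime p) (LocalizedModule p.primeCompl Y)) = ⊥ := by
    refine Submodule.eq_bot_of_le_smul_of_le_jacobson_bot
      (maximalIdeal (Localization.AtPrime p)) ⊤ Module.Finite.fg_top ?_
      (IsLocalRing.maximalIdeal_le_jacobson _)
    intro z _
    induction z using LocalizedModule.induction_on with
    | h y s =>
      obtain ⟨t, ht, hmem⟩ := key y
      have h3 : ∀ w ∈ p • (⊤ : Submodule R Y), LocalizedModule.mkLinearMap p.primeCompl Y w ∈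
          maximalIdeal (Localization.AtPrime p) •
            (⊤ : Submodule (Localization.AtPrime p) (LocalizedModule p.primeCompl Y)) := by
        intro w hw
        refine Submodule.smul_induction_on hw ?_ ?_
        · intro b hb n _
          rw [map_smul, ← algebraMap_smul (Localization.AtPrime p) b]
          refine Submodule.smul_mem_smul ?_ trivial
          exact (IsLocalization.AtPrime.to_map_mem_maximal_iff (Localization.AtPrime p) p b).2 hb
        · intro u v hu hv
          rw [map_add]
          exact add_mem hu hv
      have h4 : LocalizedModule.mk y s = Localization.mk 1 (s * ⟨t, ht⟩ : p.primeCompl) •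
          LocalizedModule.mkLinearMap p.primeCompl Y (t • y) := by
        rw [LocalizedModule.mkLinearMap_apply, LocalizedModule.mk_smul_mk, LocalizedModule.mk_eq]
        refine ⟨1, ?_⟩
        simp only [one_smul, mul_one, mul_smul]
        rfl
      rw [h4]
      exact Submodule.smul_mem _ _ (h3 _ hmem)
  intro x
  have h5 : LocalizedModule.mkLinearMap p.primeCompl Y (π x) = 0 := by
    have : LocalizedModule.mkLinearMap p.primeCompl Y (π x) ∈
      (⊤ : Submodule (Localization.AtPrime p) (LocalizedModule p.primeCompl Y)) := trivial
    rw [htop] at this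
    exact this
  obtain ⟨t, ht⟩ := (IsLocalizedModule.eq_zero_iff p.primeCompl _).1 h5
  have h6 : π ((t : R) • x) = 0 := by rw [map_smul]; exact ht
  obtain ⟨c, hc⟩ := (Submodule.Quotient.mk_eq_zero _).1 h6
  exact ⟨t, t.2, c, hc⟩

theorem exists_gen_all [Module.Finite R X] {B : Type} [AddCommGroup B] [Module R B]
    (hB : ∀ p ∈ associatedPrimes R R, ∃ h : B →ₗ[R] X, Gen p h) :
    ∃ h : B →ₗ[R] X, ∀ p ∈ associatedPrimes R R, Gen p h := by
  classical
  have hfin := associatedPrimes.finite R R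
  let S : Finset (Ideal R) := hfin.toFinset.filter fun p =>
    ∀ q ∈ associatedPrimes R R, p ≤ q → q ≤ p
  have hS : ∀ p ∈ S, p ∈ associatedPrimes R R ∧ ∀ q ∈ associatedPrimes R R, p ≤ q → q ≤ p := by
    intro p hp
    have := Finset.mem_filter.1 hp
    exact ⟨hfin.mem_toFinset.1 this.1, this.2⟩
  have ha : ∀ p : Ideal R, p ∈ S → ∃ a : R, a ∉ p ∧ ∀ q ∈ S, q ≠ p → a ∈ q := by
    intro p hp
    have hprime : p.IsPrime := (hS p hp).1.1
    have : ¬ ((S.erase p).inf id ≤ p) := by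
      rw [Ideal.IsPrime.inf_le' hprime]
      rintro ⟨q, hq, hqp⟩
      obtain ⟨hne, hqS⟩ := Finset.mem_erase.1 hq
      exact hne (le_antisymm hqp ((hS q hqS).2 p (hS p hp).1 hqp))
    obtain ⟨a, ha, hap⟩ := SetLike.not_le_iff_exists.1 this
    refine ⟨a, hap, fun q hq hne => ?_⟩
    exact (Finset.inf_le (f := id) (Finset.mem_erase.2 ⟨hne, hq⟩)) ha
  choose! a ha1 ha2 using ha
  choose! h hh using hB
  refine ⟨∑ q ∈ S, a q • h q, ?_⟩
  have hmain : ∀ p ∈ S, Gen p (∑ q ∈ S, a q • h q) := by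
    intro p hp
    have hprime : p.IsPrime := (hS p hp).1.1
    refine gen_nak p (h p) _ (a p) (ha1 p hp) (hh p (hS p hp).1) fun c => ?_
    rw [← Finset.add_sum_erase S _ hp, LinearMap.add_apply, LinearMap.smul_apply, add_sub_cancel_left,
      LinearMap.sum_apply]
    refine Submodule.sum_mem _ fun q hq => ?_
    obtain ⟨hne, hqS⟩ := Finset.mem_erase.1 hq
    exact Submodule.smul_mem_smul (ha2 q hqS p hp (Ne.symm hne)) trivial
  intro p hp
  obtain ⟨q, hpq, hq⟩ := hfin.exists_le_maximal hp
  have hqS : q ∈ S := Finset.mem_filter.2 ⟨hfin.mem_toFinset.2 hq.1, fun r hr hqr => hq.2 hr hqr⟩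
  intro x
  obtain ⟨t, ht, c, hc⟩ := hmain q hqS x
  exact ⟨t, fun hmem => ht (hpq hmem), c, hc⟩

theorem rank_embed [Module.Finite R X] {s : ℕ} (hX : HasRankN R X s) :
    ∃ f : (Fin s → R) →ₗ[R] X, Function.Injective f ∧
      Module.IsTorsion R (X ⧸ LinearMap.range f) := by
  obtain ⟨f, hf⟩ := exists_gen_all (R := R) (X := X) (B := Fin s → R) (by
    intro p hp
    have hprime : p.IsPrime := hp.1
    obtain ⟨e⟩ := hX p hprime hp
    exact exists_gen p e)
  refine ⟨f, ?_, ?_⟩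
  · rw [injective_iff_map_eq_zero]
    intro c hc
    let I : Ideal R := LinearMap.ker (LinearMap.toSpanSingleton R (Fin s → R) c)
    have hI : ∀ t, t ∈ I ↔ t • c = 0 := fun t => Iff.rfl
    obtain ⟨a, haI, ha⟩ := exists_nzd I (by
      intro p hp
      have hprime : p.IsPrime := hp.1
      obtain ⟨e⟩ := hX p hprime hp
      have hsurj : Function.Surjective (LocalizedModule.map p.primeCompl f) := by
        intro z
        induction z using LocalizedModule.induction_on with
        | h x u =>
          obtain ⟨t, ht, b, hb⟩ := hf p hp x
          refine ⟨LocalizedModule.mk b (⟨t, ht⟩ * u), ?_⟩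
          rw [LocalizedModule.map_mk, LocalizedModule.mk_eq, hb]
          refine ⟨1, ?_⟩
          simp only [one_smul, mul_smul]
          exact smul_comm _ _ _
      have : Nontrivial R := ⟨⟨0, 1, fun h01 => hprime.ne_top ((Ideal.eq_top_iff_one p).2 (h01 ▸ p.zero_mem))⟩⟩
      obtain ⟨e'⟩ := (fr_iff _ _).1 (fr_loc_free (R := R) p (Fin s → R))
      have hinj : Function.Injective (LocalizedModule.map p.primeCompl f) := by
        rw [Module.finrank_fin_fun] at e'
        let g := (e'.symm.toLinearMap ∘ₗ e.toLinearMap) ∘ₗ LocalizedModule.map p.primeCompl f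
        have hg : Function.Surjective g :=
          (e'.symm.surjective.comp e.surjective).comp hsurj
        have hg2 : Function.Injective g := OrzechProperty.injective_of_surjective_endomorphism g hg
        intro x y hxy
        apply hg2
        change e'.symm (e _) = e'.symm (e _)
        rw [hxy]
      have h0 : LocalizedModule.mkLinearMap p.primeCompl (Fin s → R) c = 0 := by
        apply hinj
        rw [map_zero]
        have h1 : LocalizedModule.map p.primeCompl f
          (LocalizedModule.mkLinearMap p.primeCompl (Fin s → R) c) =
          LocalizedModule.mkLinearMap p.primeCompl X (f c) := LocalizedModule.map_mk _ f c 1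
        rw [h1, hc, map_zero]
      obtain ⟨t, ht⟩ := (IsLocalizedModule.eq_zero_iff p.primeCompl _).1 h0
      exact ⟨t, ht, t.2⟩)
    funext i
    have h2 : a * c i = 0 := congrFun ((hI a).1 haI) i
    exact (mul_left_mem_nonZeroDivisors_eq_zero_iff ha).1 h2
  · intro y
    obtain ⟨x, rfl⟩ := Submodule.mkQ_surjective _ y
    let I : Ideal R := LinearMap.ker (LinearMap.toSpanSingleton R _ ((LinearMap.range f).mkQ x))
    obtain ⟨a, haI, ha⟩ := exists_nzd I (by
      intro p hp
      obtain ⟨t, ht, b, hb⟩ := hf p hp x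
      refine ⟨t, ?_, ht⟩
      change t • (LinearMap.range f).mkQ x = 0
      rw [← map_smul]
      exact (Submodule.Quotient.mk_eq_zero _).2 ⟨b, hb⟩)
    exact ⟨⟨a, ha⟩, haI⟩

end Embed


section Main

variable {R : Type} [CommRing R] [IsNoetherianRing R] [IsLocalRing R]
  (M : Type) [AddCommGroup M] [Module R M]

theorem syz_step (j : ℕ) : ∀ (C : Type) [AddCommGroup C] [Module R C] [Module.Finite R C],
    (∃ rk, HasRankN R C rk) →
    ∃ (K : Type) (_ : AddCommGroup K) (_ : Module R K) (_ : Module.Finite R K),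
      (∃ rk, HasRankN R K rk) ∧
      (∀ i, Subsingleton (TorM R (i + 1 + j) M C) ↔ Subsingleton (TorM R (i + 1) M K)) ∧
      (Subsingleton (TorM R j M C) → ∀ (m : ℕ) (h : K →ₗ[R] (Fin m → R)),
        (∀ φ : K →ₗ[R] R, ∃ ψ : (Fin m → R) →ₗ[R] R, ψ ∘ₗ h = φ) →
          Function.Injective (h.lTensor M)) ∧
      (∀ i, 1 ≤ i → EV R (i + j) C R → EV R i K R) := by
  induction j with
  | zero =>
    intro C _ _ _ hC
    refine ⟨C, inferInstance, inferInstance, inferInstance, hC, fun i => Iff.rfl, ?_,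
      fun i _ h => h⟩
    intro h m f _
    rw [tor_zero] at h
    exact Function.injective_of_subsingleton _
  | succ j ih =>
    intro C _ _ _ hC
    obtain ⟨m, A, _, _, _, f, g, hf, hfg, hg⟩ := exists_syz (R := R) C
    have hA := rank_syz hf hfg hg hC
    cases j with
    | zero =>
      refine ⟨A, inferInstance, inferInstance, inferInstance, hA,
        fun i => tor_shift M f g hf hfg hg i, ?_,
        fun i _ h => ?_⟩
      · intro h m' h' hext
        have h1 := (tor_shift_one M f g hf hfg hg).1 h
        choose ψ hψ using fun i : Fin m => hext (LinearMap.proj i ∘ₗ f)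
        have h2 : LinearMap.pi ψ ∘ₗ h' = f := by
          apply LinearMap.ext
          intro x
          funext i
          exact congrArg (fun k => k x) (hψ i)
        rw [← h2, LinearMap.lTensor_comp, LinearMap.coe_comp] at h1
        exact h1.of_comp
      · obtain ⟨l, rfl⟩ := Nat.exists_eq_add_of_le' ‹1 ≤ i›
        exact ev_left hf hfg hg R (l + 1) (ev_proj R l) h
    | succ j =>
      obtain ⟨K, _, _, _, hK, h1, h2, h3⟩ := ih A hA
      refine ⟨K, inferInstance, inferInstance, inferInstance, hK, fun i => ?_, fun h => ?_,
        fun i hi h => ?_⟩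
      · rw [← h1 i]
        have := tor_shift M f g hf hfg hg (i + 1 + j)
        exact this
      · exact h2 ((tor_shift M f g hf hfg hg j).1 h)
      · refine h3 i hi ?_
        exact ev_left hf hfg hg R (i + j + 1) (ev_proj R (i + j)) h

theorem cosyz_iter (d : ℕ)
    (hinj : ∀ (N : Type) [AddCommGroup N] [Module R N] [Module.Finite R N],
      ∀ i, d < i → EV R i N R) (e : ℕ) :
    ∀ (K : Type) [AddCommGroup K] [Module R K] [Module.Finite R K],
    (∃ rk, HasRankN R K rk) → GG R K →
    ∃ (X : Type) (_ : AddCommGroup X) (_ : Module R X) (_ : Module.Finite R X),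
      (∃ rk, HasRankN R X rk) ∧ GG R X ∧
      (∀ i, Subsingleton (TorM R (i + 1) M K) ↔ Subsingleton (TorM R (i + e + 1) M X)) := by
  induction e with
  | zero =>
    intro K _ _ _ h1 h2
    exact ⟨K, inferInstance, inferInstance, inferInstance, h1, h2, fun i => Iff.rfl⟩
  | succ e ih =>
    intro K _ _ _ h1 h2
    obtain ⟨X, _, _, _, hX1, hX2, hX3⟩ := ih K h1 h2
    obtain ⟨m, Y, _, _, _, f, g, hf, hfg, hg, hY, hext⟩ := exists_cosyz d hinj X hX2
    refine ⟨Y, inferInstance, inferInstance, inferInstance, rank_cosyz hf hfg hg hext hX1, hY,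
      fun i => ?_⟩
    rw [hX3 i]
    exact (tor_shift M f g hf hfg hg (i + e)).symm

theorem main_shift (d : ℕ)
    (hinj : ∀ (N : Type) [AddCommGroup N] [Module R N] [Module.Finite R N],
      ∀ i, d < i → EV R i N R) (e : ℕ)
    (C : Type) [AddCommGroup C] [Module R C] [Module.Finite R C]
    (hC : ∃ rk, HasRankN R C rk) :
    ∃ (X : Type) (_ : AddCommGroup X) (_ : Module R X) (_ : Module.Finite R X),
      (∃ rk, HasRankN R X rk) ∧ GG R X ∧
      ∀ n, d ≤ n → Subsingleton (TorM R n M C) →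
        Subsingleton (TorM R (n + e + 1) M X) ∧
        ((∀ i, n + e + 1 ≤ i → Subsingleton (TorM R i M X)) →
          ∀ i, n ≤ i → Subsingleton (TorM R i M C)) := by
  obtain ⟨K, _, _, _, hK, h1, h2, h3⟩ := syz_step M d C hC
  have hGG : GG R K := fun i hi => h3 i hi (hinj C (i + d) (by omega))
  obtain ⟨m, Y, _, _, _, f, g, hf, hfg, hg, hY, hext⟩ := exists_cosyz d hinj K hGG
  obtain ⟨X, _, _, _, hX1, hX2, hX3⟩ := cosyz_iter M d hinj (d + e) Y
    (rank_cosyz hf hfg hg hext hK) hY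
  have hshift : ∀ i, Subsingleton (TorM R (i + 1 + d) M C) ↔
      Subsingleton (TorM R (i + 1 + d + e + 1) M X) := by
    intro i
    rw [h1 i, ← tor_shift M f g hf hfg hg i, hX3 (i + 1)]
    have : i + 1 + (d + e) + 1 = i + 1 + d + e + 1 := by omega
    rw [this]
  refine ⟨X, inferInstance, inferInstance, inferInstance, hX1, hX2, fun n hn hT => ⟨?_, ?_⟩⟩
  · rcases hn.eq_or_lt with rfl | hlt
    · have h4 := (hX3 0).1 ((tor_shift_one M f g hf hfg hg).2 (h2 hT m f hext))
      rw [Nat.zero_add] at h4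
      exact h4
    · obtain ⟨i, rfl⟩ : ∃ i, n = i + 1 + d := ⟨n - d - 1, by omega⟩
      exact (hshift i).1 hT
  · intro hX i hi
    rcases hi.eq_or_lt with rfl | hlt
    · exact hT
    · obtain ⟨i, rfl⟩ : ∃ j, i = j + 1 + d := ⟨i - d - 1, by omega⟩
      exact (hshift i).2 (hX _ (by omega))

end Main


theorem tor_rigidity_torsion_mcm_rank_tfae
    (R : Type) [CommRing R] [IsNoetherianRing R] [IsLocalRing R]
    (d : ℕ) (hGor : IsGorensteinOfDim R d)
    (M : Type) [AddCommGroup M] [Module R M] [Module.Finite R M]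
     :
    ((∀ (C : Type) [AddCommGroup C] [Module R C] [Module.Finite R C],
        Module.IsTorsion R C →
        ∀ n : ℕ, d ≤ n → Subsingleton (TorM R n M C) →
          ∀ i : ℕ, n ≤ i → Subsingleton (TorM R i M C)) ↔
     (∀ (C : Type) [AddCommGroup C] [Module R C] [Module.Finite R C],
        IsMCM R d C → (∃ rk : ℕ, HasRankN R C rk) →
        ∀ n : ℕ, d ≤ n → Subsingleton (TorM R n M C) →
          ∀ i : ℕ, n ≤ i → Subsingleton (TorM R i M C))) ∧
    ((∀ (C : Type) [AddCommGroup C] [Module R C] [Module.Finite R C],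
        IsMCM R d C → (∃ rk : ℕ, HasRankN R C rk) →
        ∀ n : ℕ, d ≤ n → Subsingleton (TorM R n M C) →
          ∀ i : ℕ, n ≤ i → Subsingleton (TorM R i M C)) ↔
     (∀ (C : Type) [AddCommGroup C] [Module R C] [Module.Finite R C],
        (∃ rk : ℕ, HasRankN R C rk) →
        ∀ n : ℕ, d ≤ n → Subsingleton (TorM R n M C) →
          ∀ i : ℕ, n ≤ i → Subsingleton (TorM R i M C))) := by
  have hinj : ∀ (N : Type) [AddCommGroup N] [Module R N] [Module.Finite R N],
      ∀ i, d < i → EV R i N R := by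
    intro N _ _ _ i hi
    exact injdim d (fun i hi => (extM_iff i _ _).1 (hGor.2.1 i (by omega))) N i hi
  have hdep : ∀ i, i < d → EV R i (resF R) R := fun i hi =>
    (extM_iff i _ _).1 (hGor.2.1 i (by omega))
  have htop : ¬ EV R d (resF R) R := by
    intro h
    obtain ⟨e⟩ := hGor.2.2
    have h1 : Subsingleton (ExtM R d (resF R) R) := (extM_iff d _ _).2 h
    have h2 : Subsingleton (resF R) := e.symm.toEquiv.subsingleton
    exact not_subsingleton (resF R) h2
  have i_iii : (∀ (C : Type) [AddCommGroup C] [Module R C] [Module.Finite R C],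
        Module.IsTorsion R C →
        ∀ n : ℕ, d ≤ n → Subsingleton (TorM R n M C) →
          ∀ i : ℕ, n ≤ i → Subsingleton (TorM R i M C)) →
      (∀ (C : Type) [AddCommGroup C] [Module R C] [Module.Finite R C],
        (∃ rk : ℕ, HasRankN R C rk) →
        ∀ n : ℕ, d ≤ n → Subsingleton (TorM R n M C) →
          ∀ i : ℕ, n ≤ i → Subsingleton (TorM R i M C)) := by
    intro h C _ _ _ hC n hn hT
    obtain ⟨X, _, _, _, ⟨s, hs⟩, hGX, hX⟩ := main_shift M d hinj 1 C hC
    obtain ⟨h1, h2⟩ := hX n hn hT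
    obtain ⟨f, hf, htor⟩ := rank_embed hs
    have hq : ∀ n, Subsingleton (TorM R (n + 2) M (X ⧸ LinearMap.range f)) ↔
        Subsingleton (TorM R (n + 2) M X) := fun n =>
      tor_quot M n f (LinearMap.range f).mkQ hf (LinearMap.exact_iff.2 (Submodule.ker_mkQ _))
        (Submodule.mkQ_surjective _)
    refine h2 fun i hi => ?_
    have h3 := h _ htor (n + 2) (by omega) ((hq n).2 h1) i hi
    obtain ⟨i, rfl⟩ : ∃ j, i = j + 2 := ⟨i - 2, by omega⟩
    exact (hq i).1 h3
  have iii_i : (∀ (C : Type) [AddCommGroup C] [Module R C] [Module.Finite R C],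
        (∃ rk : ℕ, HasRankN R C rk) →
        ∀ n : ℕ, d ≤ n → Subsingleton (TorM R n M C) →
          ∀ i : ℕ, n ≤ i → Subsingleton (TorM R i M C)) →
      (∀ (C : Type) [AddCommGroup C] [Module R C] [Module.Finite R C],
        Module.IsTorsion R C →
        ∀ n : ℕ, d ≤ n → Subsingleton (TorM R n M C) →
          ∀ i : ℕ, n ≤ i → Subsingleton (TorM R i M C)) := by
    intro h C _ _ _ hC
    exact h C ⟨0, torsion_rank C hC⟩
  have ii_iii : (∀ (C : Type) [AddCommGroup C] [Module R C] [Module.Finite R C],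
        IsMCM R d C → (∃ rk : ℕ, HasRankN R C rk) →
        ∀ n : ℕ, d ≤ n → Subsingleton (TorM R n M C) →
          ∀ i : ℕ, n ≤ i → Subsingleton (TorM R i M C)) →
      (∀ (C : Type) [AddCommGroup C] [Module R C] [Module.Finite R C],
        (∃ rk : ℕ, HasRankN R C rk) →
        ∀ n : ℕ, d ≤ n → Subsingleton (TorM R n M C) →
          ∀ i : ℕ, n ≤ i → Subsingleton (TorM R i M C)) := by
    intro h C _ _ _ hC n hn hT
    obtain ⟨X, _, _, _, hXr, hGX, hX⟩ := main_shift M d hinj 0 C hC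
    obtain ⟨h1, h2⟩ := hX n hn hT
    have hfg : Function.Exact (LinearMap.inl R X R) (LinearMap.snd R X R) :=
      Function.Exact.inl_snd
    have hmcm : IsMCM R d (X × R) := by
      constructor
      · intro i hi
        rw [extM_iff]
        exact ev_covmid LinearMap.inl_injective hfg Prod.snd_surjective (resF R) i
          (gg_depth d hinj (resF R) hdep i hi X hGX) (hdep i hi)
      · rw [← not_subsingleton_iff_nontrivial, extM_iff]
        intro hsub
        exact htop (ev_retract (LinearMap.inr R X R) (LinearMap.snd R X R)
          (LinearMap.snd_comp_inr R X R) d hsub)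
    have hrk : ∃ rk, HasRankN R (X × R) rk :=
      rank_ext LinearMap.inl_injective hfg Prod.snd_surjective hXr
    have hp : ∀ n, Subsingleton (TorM R (n + 1) M (X × R)) ↔ Subsingleton (TorM R (n + 1) M X) :=
      fun n => tor_prod M n
    refine h2 fun i hi => ?_
    have h3 := h (X × R) hmcm hrk (n + 1) (by omega) ((hp n).2 h1) i hi
    obtain ⟨i, rfl⟩ : ∃ j, i = j + 1 := ⟨i - 1, by omega⟩
    exact (hp i).1 h3
  refine ⟨⟨fun h C _ _ _ _ => i_iii h C, fun h => iii_i (ii_iii h)⟩,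
    ⟨ii_iii, fun h C _ _ _ _ => h C⟩⟩
end

section
/- Let R be a local ring and M a finitely generated R-module of finite Gorenstein dimension g. Then there exists a short exact sequence 0 → M → X → G → 0 of finitely generated R-modules where pd_R(X) = g and G is totally reflexive. -/
open CategoryTheory IsLocalRing

namespace FPH

open CategoryTheory.Limits

section ExtPart

variable {R : Type} [CommRing R]

lemma ext_cmp (n : ℕ) (A B : Type) [AddCommGroup A] [Module R A] [AddCommGroup B] [Module R B] :
    Subsingleton (ExtM R (n + 1) A B) ↔
      Subsingleton (Abelian.Ext (ModuleCat.of R A) (ModuleCat.of R B) (n + 1)) := by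
  let P := projectiveResolution (ModuleCat.of R A)
  have key : Subsingleton (ExtM R (n + 1) A B) ↔
      ∀ φ : P.complex.X (n + 1) ⟶ ModuleCat.of R B, P.complex.d (n + 2) (n + 1) ≫ φ = 0 →
        ∃ ψ : P.complex.X n ⟶ ModuleCat.of R B, P.complex.d (n + 1) n ≫ ψ = φ := by
    have h1 : Subsingleton (ExtM R (n + 1) A B) ↔
        IsZero ((P.complex.linearYonedaObj R (ModuleCat.of R B)).homology (n + 1)) := by
      rw [← (P.isoExt (R := R) (n + 1) (ModuleCat.of R B)).isZero_iff]
      exact ModuleCat.isZero_iff_subsingleton.symm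
    rw [h1, ← HomologicalComplex.exactAt_iff_isZero_homology,
      HomologicalComplex.exactAt_iff' _ n (n + 1) (n + 2) (by simp) (by simp),
      ShortComplex.moduleCat_exact_iff]
    rfl
  rw [key]
  constructor
  · intro h
    refine subsingleton_of_forall_eq 0 fun α => ?_
    obtain ⟨f, hf, rfl⟩ := P.extMk_surjective α (n + 2) rfl
    rw [P.extMk_eq_zero_iff f (n + 2) rfl hf n rfl]
    exact h f hf
  · intro h φ hφ
    rw [← P.extMk_eq_zero_iff φ (n + 2) rfl hφ n rfl]
    exact Subsingleton.elim _ _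

/-- All higher `Ext` groups into `R` vanish. -/
def EZ (R : Type) [CommRing R] (A : Type) [AddCommGroup A] [Module R A] : Prop :=
  ∀ n : ℕ, Subsingleton (Abelian.Ext (ModuleCat.of R A) (ModuleCat.of R R) (n + 1))

lemma EZ_iff (A : Type) [AddCommGroup A] [Module R A] :
    (∀ i : ℕ, 1 ≤ i → Subsingleton (ExtM R i A R)) ↔ EZ R A := by
  constructor
  · intro h n
    exact (ext_cmp n A R).1 (h (n + 1) (by omega))
  · intro h i hi
    obtain ⟨n, rfl⟩ : ∃ n, i = n + 1 := ⟨i - 1, by omega⟩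
    exact (ext_cmp n A R).2 (h n)

variable {A B C : Type} [AddCommGroup A] [Module R A] [AddCommGroup B] [Module R B]
  [AddCommGroup C] [Module R C]

/-- Elementary short exact sequences. -/
structure SES (f : A →ₗ[R] B) (g : B →ₗ[R] C) : Prop where
  inj : Function.Injective f
  surj : Function.Surjective g
  ex : LinearMap.range f = LinearMap.ker g

lemma SES.zero {f : A →ₗ[R] B} {g : B →ₗ[R] C} (h : SES f g) (a : A) : g (f a) = 0 := by
  have : f a ∈ LinearMap.ker g := h.ex ▸ LinearMap.mem_range_self f a
  exact this

lemma SES.lift {f : A →ₗ[R] B} {g : B →ₗ[R] C} (h : SES f g) (b : B) (hb : g b = 0) :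
    ∃ a, f a = b := by
  have : b ∈ LinearMap.range f := h.ex ▸ hb
  exact this

/-- The associated short complex. -/
abbrev SES.sc {f : A →ₗ[R] B} {g : B →ₗ[R] C} (h : SES f g) : ShortComplex (ModuleCat R) :=
  ShortComplex.mk (ModuleCat.ofHom f) (ModuleCat.ofHom g) (by
    ext a; exact h.zero a)

lemma SES.se {f : A →ₗ[R] B} {g : B →ₗ[R] C} (h : SES f g) : h.sc.ShortExact where
  exact := by
    rw [ShortComplex.moduleCat_exact_iff]
    exact fun b hb => h.lift b hb
  mono_f := (ModuleCat.mono_iff_injective _).2 h.inj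
  epi_g := (ModuleCat.epi_iff_surjective _).2 h.surj

lemma EZ.mid {f : A →ₗ[R] B} {g : B →ₗ[R] C} (h : SES f g) (hA : EZ R A) (hC : EZ R C) :
    EZ R B := by
  intro n
  refine subsingleton_of_forall_eq 0 fun x => ?_
  have := hA n
  have := hC n
  obtain ⟨y, hy⟩ := Abelian.Ext.contravariant_sequence_exact₂ h.se (ModuleCat.of R R) x
    ((hA n).elim _ _)
  rw [← hy, (hC n).elim y 0]
  simp

lemma EZ.left {f : A →ₗ[R] B} {g : B →ₗ[R] C} (h : SES f g) (hB : EZ R B) (hC : EZ R C) :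
    EZ R A := by
  intro n
  refine subsingleton_of_forall_eq 0 fun x => ?_
  obtain ⟨y, hy⟩ := Abelian.Ext.contravariant_sequence_exact₁ h.se (ModuleCat.of R R) x
    (n₁ := n + 1 + 1) (by omega) ((hC (n + 1)).elim _ _)
  rw [← hy, (hB n).elim y 0]
  simp

lemma EZ.extend {f : A →ₗ[R] B} {g : B →ₗ[R] C} (h : SES f g) (hC : EZ R C) (φ : A →ₗ[R] R) :
    ∃ ψ : B →ₗ[R] R, ψ ∘ₗ f = φ := by
  obtain ⟨y, hy⟩ := Abelian.Ext.contravariant_sequence_exact₁ h.se (ModuleCat.of R R)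
    (Abelian.Ext.mk₀ (ModuleCat.ofHom φ))
    (n₁ := 0 + 1) (by omega) ((hC 0).elim _ _)
  obtain ⟨ψ, rfl⟩ := (Abelian.Ext.mk₀_bijective _ _).2 y
  rw [Abelian.Ext.mk₀_comp_mk₀] at hy
  have := (Abelian.Ext.mk₀_bijective _ _).1 hy
  refine ⟨ψ.hom, ?_⟩
  have h2 := congrArg ModuleCat.Hom.hom this
  exact h2

lemma EZ.right {f : A →ₗ[R] B} {g : B →ₗ[R] C} (h : SES f g) (hA : EZ R A) (hB : EZ R B)
    (hs : ∀ φ : A →ₗ[R] R, ∃ ψ : B →ₗ[R] R, ψ ∘ₗ f = φ) : EZ R C := by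
  intro n
  refine subsingleton_of_forall_eq 0 fun x => ?_
  obtain ⟨y, hy⟩ := Abelian.Ext.contravariant_sequence_exact₃ h.se (ModuleCat.of R R) x
    ((hB n).elim _ _) (n₀ := n) (by omega)
  rw [← hy]
  cases n with
  | succ n =>
    rw [(hA n).elim y 0]
    simp
  | zero =>
    obtain ⟨φ, rfl⟩ := (Abelian.Ext.mk₀_bijective _ _).2 y
    obtain ⟨ψ, hψ⟩ := hs φ.hom
    have : φ = h.sc.f ≫ ModuleCat.ofHom ψ := by
      ext x
      exact (LinearMap.congr_fun hψ x).symm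
    rw [this, ← Abelian.Ext.mk₀_comp_mk₀]
    exact h.se.extClass_comp_assoc _

lemma EZ.proj [Module.Projective R A] : EZ R A := by
  intro n
  have : Projective (ModuleCat.of R A) := (IsProjective.iff_projective A).1 inferInstance
  exact Abelian.Ext.subsingleton_of_projective _ _ _

lemma EZ.equiv (e : A ≃ₗ[R] B) (hA : EZ R A) : EZ R B := by
  have h : SES (e : A →ₗ[R] B) (0 : B →ₗ[R] PUnit) :=
    ⟨e.injective, fun x => ⟨0, Subsingleton.elim _ _⟩, by simp⟩
  exact EZ.mid h hA EZ.proj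

end ExtPart

section TRPart

variable {R : Type} [CommRing R]
variable {A B C : Type} [AddCommGroup A] [Module R A] [AddCommGroup B] [Module R B]
  [AddCommGroup C] [Module R C]

lemma TR_iff : IsTotallyReflexive R A ↔
    Module.Finite R A ∧ Function.Bijective (Module.Dual.eval R A) ∧ EZ R A ∧
      EZ R (Module.Dual R A) := by
  unfold IsTotallyReflexive
  rw [EZ_iff, EZ_iff]

lemma TR_free (A : Type) [AddCommGroup A] [Module R A] [Module.Finite R A] [Module.Free R A] :
    IsTotallyReflexive R A :=
  TR_iff.2 ⟨inferInstance, Module.bijective_dual_eval R A, EZ.proj, EZ.proj⟩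

lemma TR_equiv (e : A ≃ₗ[R] B) (h : IsTotallyReflexive R A) : IsTotallyReflexive R B := by
  rw [TR_iff] at h ⊢
  obtain ⟨h1, h2, h3, h4⟩ := h
  have : Module.IsReflexive R A := ⟨h2⟩
  have : Module.IsReflexive R B := Module.equiv e
  exact ⟨Module.Finite.equiv e, Module.bijective_dual_eval R B, h3.equiv e,
    h4.equiv e.symm.dualMap⟩

lemma TR_dual [IsNoetherianRing R] (h : IsTotallyReflexive R A) :
    IsTotallyReflexive R (Module.Dual R A) := by
  rw [TR_iff] at h ⊢
  obtain ⟨h1, h2, h3, h4⟩ := h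
  have : Module.IsReflexive R A := ⟨h2⟩
  exact ⟨inferInstance, Module.bijective_dual_eval R _, h4, h3.equiv (Module.evalEquiv R A)⟩

lemma SES.dual {f : A →ₗ[R] B} {g : B →ₗ[R] C} (h : SES f g) (hC : EZ R C) :
    SES g.dualMap f.dualMap where
  inj := LinearMap.dualMap_injective_of_surjective h.surj
  surj := fun φ => EZ.extend h hC φ
  ex := by
    ext φ
    constructor
    · rintro ⟨ψ, rfl⟩
      ext a
      simp [h.zero a]
    · intro hφ
      have hφ' : ∀ a, φ (f a) = 0 := fun a => LinearMap.congr_fun hφ a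
      have hk : LinearMap.ker g ≤ LinearMap.ker φ := by
        intro b hb
        obtain ⟨a, rfl⟩ := h.lift b hb
        exact hφ' a
      refine ⟨(LinearMap.ker g).liftQ φ hk ∘ₗ (g.quotKerEquivOfSurjective h.surj).symm, ?_⟩
      ext b
      have : (g.quotKerEquivOfSurjective h.surj).symm (g b) = Submodule.Quotient.mk b := by
        rw [LinearEquiv.symm_apply_eq]; rfl
      simp [LinearMap.dualMap_apply, this]

lemma TR_ker [IsNoetherianRing R] {f : A →ₗ[R] B} {g : B →ₗ[R] C} (h : SES f g)
    (hB : IsTotallyReflexive R B) (hC : IsTotallyReflexive R C) : IsTotallyReflexive R A := by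
  rw [TR_iff] at hB hC ⊢
  obtain ⟨B1, B2, B3, B4⟩ := hB
  obtain ⟨C1, C2, C3, C4⟩ := hC
  have hd := h.dual C3
  refine ⟨Module.Finite.of_injective f h.inj, ⟨?_, ?_⟩, EZ.left h B3 C3, ?_⟩
  · intro a a' haa
    apply h.inj
    apply B2.1
    ext φ
    exact LinearMap.congr_fun haa (f.dualMap φ)
  · intro φ
    obtain ⟨b, hb⟩ := B2.2 (φ ∘ₗ f.dualMap)
    have hgb : g b = 0 := by
      apply C2.1
      ext ψ
      have h1 := LinearMap.congr_fun hb (g.dualMap ψ)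
      have h2 : f.dualMap (g.dualMap ψ) = 0 := hd.zero ψ
      simp only [LinearMap.comp_apply, h2, map_zero] at h1
      simpa using h1
    obtain ⟨a, rfl⟩ := h.lift b hgb
    refine ⟨a, ?_⟩
    ext ψ
    obtain ⟨χ, rfl⟩ := hd.surj ψ
    exact LinearMap.congr_fun hb χ
  · refine EZ.right hd C4 B4 fun φ => ?_
    obtain ⟨c, rfl⟩ := C2.2 φ
    obtain ⟨b, rfl⟩ := h.surj c
    exact ⟨Module.Dual.eval R B b, rfl⟩

lemma TR_mid {f : A →ₗ[R] B} {g : B →ₗ[R] C} (h : SES f g)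
    (hA : IsTotallyReflexive R A) (hC : IsTotallyReflexive R C) : IsTotallyReflexive R B := by
  rw [TR_iff] at hA hC ⊢
  obtain ⟨A1, A2, A3, A4⟩ := hA
  obtain ⟨C1, C2, C3, C4⟩ := hC
  have hd := h.dual C3
  refine ⟨Module.Finite.of_exact (LinearMap.exact_iff.2 h.ex.symm) h.surj, ⟨?_, ?_⟩, EZ.mid h A3 C3, EZ.mid hd C4 A4⟩
  · rw [injective_iff_map_eq_zero]
    intro b hb
    have hgb : g b = 0 := by
      apply C2.1
      ext ψ
      simpa using LinearMap.congr_fun hb (g.dualMap ψ)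
    obtain ⟨a, rfl⟩ := h.lift b hgb
    have : a = 0 := by
      apply A2.1
      ext ψ
      obtain ⟨χ, rfl⟩ := hd.surj ψ
      simpa using LinearMap.congr_fun hb χ
    rw [this, map_zero]
  · intro φ
    obtain ⟨c, hc⟩ := C2.2 (φ ∘ₗ g.dualMap)
    obtain ⟨b, rfl⟩ := h.surj c
    have hk : LinearMap.ker f.dualMap ≤ LinearMap.ker (φ - Module.Dual.eval R B b) := by
      intro χ hχ
      obtain ⟨ψ, rfl⟩ := hd.lift χ hχ
      have := LinearMap.congr_fun hc ψ
      simp only [LinearMap.comp_apply, Module.Dual.eval_apply] at this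
      simp [← this]
    let θ : Module.Dual R (Module.Dual R A) :=
      (LinearMap.ker f.dualMap).liftQ _ hk ∘ₗ (f.dualMap.quotKerEquivOfSurjective hd.surj).symm
    obtain ⟨a, ha⟩ := A2.2 θ
    refine ⟨f a + b, ?_⟩
    ext χ
    have h1 := LinearMap.congr_fun ha (f.dualMap χ)
    have : (f.dualMap.quotKerEquivOfSurjective hd.surj).symm (f.dualMap χ) =
        Submodule.Quotient.mk χ := by
      rw [LinearEquiv.symm_apply_eq]; rfl
    simp only [θ, LinearMap.comp_apply, LinearEquiv.coe_coe, this] at h1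
    simp only [Module.Dual.eval_apply, LinearMap.dualMap_apply, Submodule.liftQ_apply,
      LinearMap.sub_apply] at h1
    simp [h1]

lemma TR_embed [IsNoetherianRing R] (hA : IsTotallyReflexive R A) :
    ∃ (n : ℕ) (L : ModuleCat R) (i : A →ₗ[R] (Fin n → R)) (q : (Fin n → R) →ₗ[R] (L : Type)),
      SES i q ∧ IsTotallyReflexive R L := by
  have hD := TR_dual hA
  have hA' := TR_iff.1 hA
  obtain ⟨A1, A2, A3, A4⟩ := hA'
  have : Module.IsReflexive R A := ⟨A2⟩
  obtain ⟨n, p, hp⟩ := Module.Finite.exists_fin' R (Module.Dual R A)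
  have hs : SES (LinearMap.ker p).subtype p := ⟨Subtype.val_injective, hp, by simp⟩
  have hK := TR_ker hs (TR_free _) hD
  have hd := hs.dual A4
  let e : (Fin n → R) ≃ₗ[R] Module.Dual R (Fin n → R) := (Pi.basisFun R (Fin n)).toDualEquiv
  refine ⟨n, ModuleCat.of R (Module.Dual R (LinearMap.ker p)),
    e.symm.toLinearMap ∘ₗ p.dualMap ∘ₗ (Module.evalEquiv R A).toLinearMap,
    (LinearMap.ker p).subtype.dualMap ∘ₗ e.toLinearMap, ⟨?_, ?_, ?_⟩, TR_dual hK⟩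
  · exact e.symm.injective.comp (hd.inj.comp (Module.evalEquiv R A).injective)
  · exact hd.surj.comp e.surjective
  · ext x
    constructor
    · rintro ⟨a, rfl⟩
      simpa using hd.zero _
    · intro hx
      obtain ⟨φ, hφ⟩ := hd.lift (e x) hx
      refine ⟨(Module.evalEquiv R A).symm φ, ?_⟩
      simp only [LinearMap.comp_apply, LinearEquiv.coe_coe, LinearEquiv.apply_symm_apply, hφ,
        LinearEquiv.symm_apply_apply]

end TRPart

section Construction

variable {R : Type} [CommRing R]

lemma pushout_ses {N G0 M X' G' : Type} [AddCommGroup N] [Module R N] [AddCommGroup G0]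
    [Module R G0] [AddCommGroup M] [Module R M] [AddCommGroup X'] [Module R X']
    [AddCommGroup G'] [Module R G'] {ι : N →ₗ[R] G0} {ε : G0 →ₗ[R] M}
    {f : N →ₗ[R] X'} {h : X' →ₗ[R] G'} (h1 : SES ι ε) (h2 : SES f h) :
    ∃ (Y : ModuleCat R) (a : G0 →ₗ[R] (Y : Type)) (c : (Y : Type) →ₗ[R] G')
      (b : X' →ₗ[R] (Y : Type)) (e : (Y : Type) →ₗ[R] M), SES a c ∧ SES b e := by
  let K : Submodule R (G0 × X') := LinearMap.range (ι.prod (-f))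
  have memK : ∀ x y, (x, y) ∈ K ↔ ∃ n, ι n = x ∧ f n = -y := by
    intro x y
    constructor
    · rintro ⟨n, hn⟩
      have h1 := congrArg Prod.fst hn
      have h2 : -f n = y := congrArg Prod.snd hn
      refine ⟨n, h1, ?_⟩
      rw [← h2, neg_neg]
    · rintro ⟨n, h1, h2⟩
      exact ⟨n, by simp [h1, h2]⟩
  have kc : K ≤ LinearMap.ker (h ∘ₗ LinearMap.snd R G0 X') := by
    rintro ⟨x, y⟩ hxy
    obtain ⟨n, -, hn⟩ := (memK x y).1 hxy
    have := h2.zero n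
    rw [hn, map_neg, neg_eq_zero] at this
    simpa using this
  have ke : K ≤ LinearMap.ker (ε ∘ₗ LinearMap.fst R G0 X') := by
    rintro ⟨x, y⟩ hxy
    obtain ⟨n, hn, -⟩ := (memK x y).1 hxy
    have := h1.zero n
    rw [hn] at this
    simpa using this
  refine ⟨ModuleCat.of R ((G0 × X') ⧸ K), K.mkQ ∘ₗ LinearMap.inl R G0 X', K.liftQ _ kc,
    K.mkQ ∘ₗ LinearMap.inr R G0 X', K.liftQ _ ke, ⟨?_, ?_, ?_⟩, ⟨?_, ?_, ?_⟩⟩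
  · rw [injective_iff_map_eq_zero]
    intro x hx
    have hx' : (x, (0 : X')) ∈ K := (Submodule.Quotient.mk_eq_zero K).1 hx
    obtain ⟨n, rfl, hn⟩ := (memK _ _).1 hx'
    rw [neg_zero] at hn
    rw [h2.inj (hn.trans (map_zero f).symm), map_zero]
  · intro z
    obtain ⟨y, rfl⟩ := h2.surj z
    exact ⟨K.mkQ (0, y), by simp⟩
  · ext z
    constructor
    · rintro ⟨x, rfl⟩
      simp
    · obtain ⟨⟨x, y⟩, rfl⟩ := K.mkQ_surjective z
      intro hz
      have hz' : h y = 0 := by simpa using hz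
      obtain ⟨n, rfl⟩ := h2.lift y hz'
      refine ⟨x + ι n, ?_⟩
      refine (Submodule.Quotient.eq K).2 ?_
      refine (memK _ _).2 ⟨n, by simp, by simp⟩
  · rw [injective_iff_map_eq_zero]
    intro y hy
    have hy' : ((0 : G0), y) ∈ K := (Submodule.Quotient.mk_eq_zero K).1 hy
    obtain ⟨n, hn, hn'⟩ := (memK _ _).1 hy'
    rw [h1.inj (hn.trans (map_zero ι).symm), map_zero] at hn'
    exact neg_eq_zero.1 hn'.symm
  · intro z
    obtain ⟨x, rfl⟩ := h1.surj z
    exact ⟨K.mkQ (x, 0), by simp⟩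
  · ext z
    constructor
    · rintro ⟨x, rfl⟩
      simp
    · obtain ⟨⟨x, y⟩, rfl⟩ := K.mkQ_surjective z
      intro hz
      have hz' : ε x = 0 := by simpa using hz
      obtain ⟨n, rfl⟩ := h1.lift x hz'
      refine ⟨y + f n, ?_⟩
      refine (Submodule.Quotient.eq K).2 ?_
      refine (memK _ _).2 ⟨-n, by simp, by simp⟩

lemma quot_ses {X' Y M F L : Type} [AddCommGroup Y] [Module R Y] [AddCommGroup F]
    [Module R F] [AddCommGroup M] [Module R M] [AddCommGroup X'] [Module R X']
    [AddCommGroup L] [Module R L] {b : X' →ₗ[R] Y} {e : Y →ₗ[R] M}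
    {i : Y →ₗ[R] F} {q : F →ₗ[R] L} (h1 : SES b e) (h2 : SES i q) :
    ∃ (X : ModuleCat R) (f : M →ₗ[R] (X : Type)) (h : (X : Type) →ₗ[R] L)
      (p : F →ₗ[R] (X : Type)), SES f h ∧ SES (i ∘ₗ b) p := by
  let K : Submodule R F := LinearMap.range (i ∘ₗ b)
  have kq : K ≤ LinearMap.ker q := by
    rintro _ ⟨x, rfl⟩
    exact h2.zero (b x)
  have ki : LinearMap.ker e ≤ LinearMap.ker (K.mkQ ∘ₗ i) := by
    intro y hy
    obtain ⟨x, rfl⟩ := h1.lift y hy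
    exact (Submodule.Quotient.mk_eq_zero K).2 ⟨x, rfl⟩
  let f : M →ₗ[R] F ⧸ K :=
    (LinearMap.ker e).liftQ _ ki ∘ₗ (e.quotKerEquivOfSurjective h1.surj).symm.toLinearMap
  have hf : ∀ y, f (e y) = K.mkQ (i y) := by
    intro y
    have : (e.quotKerEquivOfSurjective h1.surj).symm (e y) = Submodule.Quotient.mk y := by
      rw [LinearEquiv.symm_apply_eq]; rfl
    simp only [f, LinearMap.comp_apply, LinearEquiv.coe_coe, this]
    rfl
  refine ⟨ModuleCat.of R (F ⧸ K), f, K.liftQ q kq, K.mkQ, ⟨?_, ?_, ?_⟩,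
    ⟨h2.inj.comp h1.inj, K.mkQ_surjective, by simp [K]⟩⟩
  · rw [injective_iff_map_eq_zero]
    intro m hm
    obtain ⟨y, rfl⟩ := h1.surj m
    rw [hf] at hm
    obtain ⟨x, hx⟩ := (Submodule.Quotient.mk_eq_zero K).1 hm
    rw [← h2.inj hx]
    exact h1.zero x
  · intro l
    obtain ⟨x, rfl⟩ := h2.surj l
    exact ⟨K.mkQ x, by simp⟩
  · ext z
    constructor
    · rintro ⟨m, rfl⟩
      obtain ⟨y, rfl⟩ := h1.surj m
      rw [hf]
      simpa using h2.zero y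
    · obtain ⟨x, rfl⟩ := K.mkQ_surjective z
      intro hz
      have hz' : q x = 0 := by simpa using hz
      obtain ⟨y, rfl⟩ := h2.lift x hz'
      exact ⟨e y, hf y⟩

lemma PdLE_free (m : ℕ) : PdLE R (Fin m → R) 0 := by
  refine ⟨fun i => if i = 0 then m else 0, fun i => 0, LinearMap.id, Function.surjective_id, ?_,
    ?_, ?_⟩
  · simp
  · intro i
    have : Subsingleton (Fin (if i + 1 = 0 then m else 0) → R) := by
      simp only [Nat.add_eq_zero_iff, one_ne_zero, and_false, if_false]
      infer_instance
    exact Subsingleton.elim _ _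
  · intro i hi
    simp [Nat.pos_iff_ne_zero.1 hi]

lemma PdLE_succ {X' X : Type} [AddCommGroup X] [Module R X] [AddCommGroup X'] [Module R X']
    {m k : ℕ} {j : X' →ₗ[R] (Fin m → R)} {p : (Fin m → R) →ₗ[R] X} (h : SES j p)
    (hX : PdLE R X' k) : PdLE R X (k + 1) := by
  obtain ⟨n, d, g, hg, h0, hs, hk⟩ := hX
  let n' : ℕ → ℕ := fun i => Nat.casesOn i m n
  let d' : ∀ i : ℕ, ((Fin (n' (i + 1)) → R) →ₗ[R] (Fin (n' i) → R)) := fun i =>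
    match i with
    | 0 => j ∘ₗ g
    | i + 1 => d i
  refine ⟨n', d', p, h.surj, ?_, ?_, ?_⟩
  · rw [← h.ex]
    exact (LinearMap.range_comp_of_range_eq_top j (LinearMap.range_eq_top.2 hg)).symm
  · intro i
    cases i with
    | zero =>
      refine Eq.trans ?_ h0
      exact LinearMap.ker_comp_of_ker_eq_bot g (LinearMap.ker_eq_bot.2 h.inj)
    | succ i => exact hs i
  · intro i hi
    cases i with
    | zero => omega
    | succ i => exact hk i (by omega)

lemma hull [IsNoetherianRing R] (g : ℕ) : ∀ (M : Type) [AddCommGroup M] [Module R M],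
    GdimLE R M g → ∃ (X G : ModuleCat R) (f : M →ₗ[R] (X : Type)) (h : (X : Type) →ₗ[R] (G : Type)),
      SES f h ∧ PdLE R X g ∧ IsTotallyReflexive R G := by
  induction g with
  | zero =>
    intro M _ _ hM
    obtain ⟨G, d, ε, hG, hε, h0, -, hz⟩ := hM
    have := hz 1 (by omega)
    have hinj : Function.Injective ε := by
      rw [← LinearMap.ker_eq_bot, h0, LinearMap.range_eq_bot]
      exact LinearMap.ext fun x => by rw [Subsingleton.elim x 0]; simp
    have hM := TR_equiv (LinearEquiv.ofBijective ε ⟨hinj, hε⟩) (hG 0)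
    obtain ⟨n, L, i, q, hs, hL⟩ := TR_embed hM
    exact ⟨ModuleCat.of R (Fin n → R), L, i, q, hs, PdLE_free n, hL⟩
  | succ g ih =>
    intro M _ _ hM
    obtain ⟨G, d, ε, hG, hε, h0, hs, hz⟩ := hM
    have hN : GdimLE R (LinearMap.ker ε) g := by
      have hd : ∀ x, d 0 x ∈ LinearMap.ker ε := fun x => h0 ▸ LinearMap.mem_range_self _ x
      refine ⟨fun i => G (i + 1), fun i => d (i + 1), (d 0).codRestrict _ hd, fun i => hG _, ?_,
        ?_, fun i => hs (i + 1), fun i hi => hz (i + 1) (by omega)⟩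
      · rintro ⟨y, hy⟩
        have hy' := hy
        rw [h0] at hy'
        obtain ⟨x, hx⟩ := hy'
        exact ⟨x, Subtype.ext hx⟩
      · rw [LinearMap.ker_codRestrict]
        exact hs 0
    obtain ⟨X', G', f', h', hs', hX', hG'⟩ := ih _ hN
    have h1 : SES (LinearMap.ker ε).subtype ε := ⟨Subtype.val_injective, hε, by simp⟩
    obtain ⟨Y, a, c, b, e, hac, hbe⟩ := pushout_ses h1 hs'
    have hY := TR_mid hac (hG 0) hG'
    obtain ⟨n, L, i, q, hiq, hL⟩ := TR_embed hY
    obtain ⟨X, f, h, p, hfh, hp⟩ := quot_ses hbe hiq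
    exact ⟨X, L, f, h, hfh, PdLE_succ hp hX', hL⟩

/-- Replace the degree zero term of a sequence of free modules. -/
def spliceObj (G0 : ModuleCat R) (n : ℕ → ℕ) : ℕ → ModuleCat R
  | 0 => G0
  | i + 1 => ModuleCat.of R (Fin (n (i + 1)) → R)

/-- The differentials of the modified sequence. -/
def spliceMap (G0 : ModuleCat R) (n : ℕ → ℕ) (d0 : (Fin (n 1) → R) →ₗ[R] (G0 : Type))
    (d : ∀ i : ℕ, ((Fin (n (i + 1)) → R) →ₗ[R] (Fin (n i) → R))) :
    ∀ i : ℕ, ((spliceObj G0 n (i + 1) : Type) →ₗ[R] (spliceObj G0 n i : Type))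
  | 0 => d0
  | i + 1 => d (i + 1)

lemma GdimLE_of_hull [IsNoetherianRing R] {M X G : Type} [AddCommGroup M] [Module R M]
    [AddCommGroup X] [Module R X] [AddCommGroup G] [Module R G]
    {f : M →ₗ[R] X} {h : X →ₗ[R] G} (hfh : SES f h) (hG : IsTotallyReflexive R G) (k : ℕ)
    (hX : PdLE R X k) : GdimLE R M k := by
  obtain ⟨n, d, g, hg, h0, hs, hk⟩ := hX
  let G' : Submodule R (Fin (n 0) → R) := LinearMap.ker (h ∘ₗ g)
  have h1 : SES G'.subtype (h ∘ₗ g) := ⟨Subtype.val_injective, hfh.surj.comp hg, by simp [G']⟩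
  have hG' := TR_ker h1 (TR_free _) hG
  have hd : ∀ x, d 0 x ∈ G' := by
    intro x
    have : d 0 x ∈ LinearMap.ker g := h0 ▸ LinearMap.mem_range_self _ x
    have h2 : g (d 0 x) = 0 := this
    change h (g (d 0 x)) = 0
    rw [h2, map_zero]
  let d0 : (Fin (n 1) → R) →ₗ[R] G' := (d 0).codRestrict G' hd
  have hε : ∀ x : G', (g ∘ₗ G'.subtype) x ∈ LinearMap.range f := by
    intro x
    rw [hfh.ex]
    exact x.2
  let ef := LinearEquiv.ofInjective f hfh.inj
  let ε : G' →ₗ[R] M := ef.symm.toLinearMap ∘ₗ (g ∘ₗ G'.subtype).codRestrict _ hε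
  have hfε : ∀ x : G', f (ε x) = g x := by
    intro x
    have := ef.apply_symm_apply ((g ∘ₗ G'.subtype).codRestrict _ hε x)
    exact congrArg Subtype.val this
  let T := spliceObj (ModuleCat.of R G') n
  let D := spliceMap (ModuleCat.of R G') n d0 d
  refine ⟨T, D, ε, ?_, ?_, ?_, ?_, ?_⟩
  · intro i
    cases i with
    | zero => exact hG'
    | succ i =>
      have := TR_free (R := R) (Fin (n (i + 1)) → R)
      exact this
  · intro m
    obtain ⟨x, hx⟩ := hg (f m)
    have hxG : x ∈ G' := by
      change h (g x) = 0
      rw [hx]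
      exact hfh.zero m
    refine ⟨⟨x, hxG⟩, hfh.inj ?_⟩
    exact (hfε ⟨x, hxG⟩).trans hx
  · change LinearMap.ker ε = LinearMap.range d0
    ext x
    have e1 : x ∈ LinearMap.ker ε ↔ (x : Fin (n 0) → R) ∈ LinearMap.ker g := by
      rw [LinearMap.mem_ker, LinearMap.mem_ker, ← hfε]
      exact ⟨fun hx => by rw [hx, map_zero], fun hx => hfh.inj (hx.trans (map_zero f).symm)⟩
    rw [e1, h0]
    constructor
    · rintro ⟨y, hy⟩
      exact ⟨y, Subtype.ext hy⟩
    · rintro ⟨y, rfl⟩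
      exact ⟨y, rfl⟩
  · intro i
    cases i with
    | zero =>
      refine Eq.trans ?_ (hs 0)
      exact LinearMap.ker_codRestrict _ _ _
    | succ i => exact hs (i + 1)
  · intro i hi
    cases i with
    | zero => omega
    | succ i =>
      have := hk (i + 1) hi
      change Subsingleton (Fin (n (i + 1)) → R)
      rw [this]
      infer_instance

end Construction

end FPH


theorem finite_projective_hull_exists
    (R : Type) [CommRing R] [IsNoetherianRing R] [IsLocalRing R]
    (M : Type) [AddCommGroup M] [Module R M] [Module.Finite R M]
    (g : ℕ) (hGdim : IsLeast {k : ℕ | GdimLE R M k} g) :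
    ∃ (X G : ModuleCat R) (f : M →ₗ[R] (X : Type)) (h : (X : Type) →ₗ[R] (G : Type)),
      Module.Finite R (X : Type) ∧
      Function.Injective f ∧ Function.Surjective h ∧
      LinearMap.range f = LinearMap.ker h ∧
      IsLeast {k : ℕ | PdLE R (X : Type) k} g ∧
      IsTotallyReflexive R (G : Type) := by

  obtain ⟨X, G, f, h, hs, hX, hG⟩ := FPH.hull g M hGdim.1
  refine ⟨X, G, f, h, ?_, hs.inj, hs.surj, hs.ex, ⟨hX, ?_⟩, hG⟩
  · obtain ⟨n, d, p, hp, -⟩ := hX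
    exact Module.Finite.of_surjective p hp
  · intro k hk
    exact hGdim.2 (FPH.GdimLE_of_hull hs hG k hk)
end

section
/- Let R be a local ring, M a Tor-rigid finitely generated R-module, and suppose Ext_R^n(M,M) = 0 for some n ≥ 0. Then pd_R(M) < n; in particular if Ext_R^1(M,M) = 0 and M ≅ Ω²M then M = 0. -/
open CategoryTheory IsLocalRing

namespace TR
open Matrix

/-- action of a matrix on vectors with entries in a module -/
def act {R : Type} [CommRing R] (N : Type) [AddCommGroup N] [Module R N] {a b : ℕ}
    (A : Matrix (Fin b) (Fin a) R) : (Fin a → N) →ₗ[R] (Fin b → N) :=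
  LinearMap.pi fun i => ∑ j, A i j • LinearMap.proj j

lemma act_apply {R : Type} [CommRing R] (N : Type) [AddCommGroup N] [Module R N] {a b : ℕ}
    (A : Matrix (Fin b) (Fin a) R) (x : Fin a → N) (i : Fin b) :
    act N A x i = ∑ j, A i j • x j := by
  simp [act]

/-- exactness of the sequence of matrices tensored with `N` -/
def Ex {R : Type} [CommRing R] (N : Type) [AddCommGroup N] [Module R N] {a b c : ℕ}
    (A : Matrix (Fin b) (Fin a) R) (B : Matrix (Fin c) (Fin b) R) : Prop :=
  B * A = 0 ∧ ∀ x : Fin b → N, act N B x = 0 → ∃ y, act N A y = x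

section
variable {R : Type} [CommRing R]

lemma act_R {a b : ℕ} (A : Matrix (Fin b) (Fin a) R) : act R A = A.mulVecLin := by
  ext x i
  simp [act_apply, Matrix.mulVec, dotProduct]

lemma act_mul (N : Type) [AddCommGroup N] [Module R N] {a b c : ℕ}
    (A : Matrix (Fin b) (Fin a) R) (B : Matrix (Fin c) (Fin b) R) (x : Fin a → N) :
    act N (B * A) x = act N B (act N A x) := by
  ext i
  simp only [act_apply, Matrix.mul_apply, Finset.sum_smul, Finset.smul_sum, mul_smul]
  rw [Finset.sum_comm]

lemma act_zero (N : Type) [AddCommGroup N] [Module R N] {a b : ℕ} (x : Fin a → N) :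
    act N (0 : Matrix (Fin b) (Fin a) R) x = 0 := by
  ext i
  simp [act_apply]

lemma act_comp {N N' : Type} [AddCommGroup N] [Module R N] [AddCommGroup N'] [Module R N']
    (g : N →ₗ[R] N') {a b : ℕ} (A : Matrix (Fin b) (Fin a) R) (x : Fin a → N) :
    act N' A (fun j => g (x j)) = fun i => g (act N A x i) := by
  ext i
  simp [act_apply]

/-- the chain complex -/
noncomputable def cx (p : ℕ → ℕ) (D : ∀ i, Matrix (Fin (p i)) (Fin (p (i + 1))) R)
    (h : ∀ i, D i * D (i + 1) = 0) : ChainComplex (ModuleCat.{0} R) ℕ :=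
  ChainComplex.of (fun i => ModuleCat.of R (Fin (p i) → R))
    (fun i => ModuleCat.ofHom (D i).mulVecLin) (fun i => by
      rw [← ModuleCat.ofHom_comp, ← Matrix.mulVecLin_mul, h]
      simp)

lemma cx_d (p : ℕ → ℕ) (D : ∀ i, Matrix (Fin (p i)) (Fin (p (i + 1))) R)
    (h : ∀ i, D i * D (i + 1) = 0) (i : ℕ) :
    (cx p D h).d (i + 1) i = ModuleCat.ofHom (D i).mulVecLin := by
  exact ChainComplex.of_d (fun i => ModuleCat.of R (Fin (p i) → R))
    (fun i => ModuleCat.ofHom (D i).mulVecLin) i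

/-- the resolution -/
noncomputable def pr (p : ℕ → ℕ) (D : ∀ i, Matrix (Fin (p i)) (Fin (p (i + 1))) R)
    (h : ∀ i, Ex R (D (i + 1)) (D i)) (T : Type) [AddCommGroup T] [Module R T]
    (g : (Fin (p 0) → R) →ₗ[R] T) (hg : Function.Surjective g)
    (hk : LinearMap.ker g = LinearMap.range (D 0).mulVecLin) :
    ProjectiveResolution (ModuleCat.of R T) where
  complex := cx p D (fun i => (h i).1)
  projective := fun n =>
    (IsProjective.iff_projective (R := R) (Fin (p n) → R)).1 inferInstance
  π := (ChainComplex.toSingle₀Equiv _ _).symm ⟨ModuleCat.ofHom g, by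
          rw [cx_d]
          change ModuleCat.ofHom (D 0).mulVecLin ≫ ModuleCat.ofHom g = 0
          rw [← ModuleCat.ofHom_comp, LinearMap.range_le_ker_iff.1 hk.ge]; rfl⟩
  quasiIso := ⟨fun n => by
    cases n with
    | zero => 
      rw [ChainComplex.quasiIsoAt₀_iff, ShortComplex.quasiIso_iff_of_zeros']
      · refine (ShortComplex.exact_and_epi_g_iff_of_iso
          (S₂ := ShortComplex.mk (ModuleCat.ofHom (D 0).mulVecLin) (ModuleCat.ofHom g) (by
          rw [← ModuleCat.ofHom_comp, LinearMap.range_le_ker_iff.1 hk.ge]; rfl)) ?_).2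
          ⟨?_, ?_⟩
        · refine ShortComplex.isoMk (Iso.refl _) (Iso.refl _) (Iso.refl _) ?_ ?_
          · have := cx_d p D (fun i => (h i).1) 0
            simp
            exact this.symm
          · simp
            rfl
        · rw [ShortComplex.moduleCat_exact_iff_range_eq_ker]
          exact hk.symm
        · exact (ModuleCat.epi_iff_surjective _).2 hg
      all_goals rfl
    | succ n =>
      rw [quasiIsoAt_iff_exactAt']
      · rw [HomologicalComplex.exactAt_iff' _ (n + 1 + 1) (n + 1) n (by simp) (by simp),
          ShortComplex.moduleCat_exact_iff]
        intro x hx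
        change (ModuleCat.Hom.hom ((cx p D (fun i => (h i).1)).d (n+1) n)) x = 0 at hx
        rw [cx_d] at hx
        obtain ⟨y, hy⟩ := (h n).2 x (by rw [act_R]; exact hx)
        refine ⟨y, ?_⟩
        change (ModuleCat.Hom.hom ((cx p D (fun i => (h i).1)).d (n+2) (n+1))) y = x
        rw [cx_d]
        rw [act_R] at hy
        exact hy
      · apply ChainComplex.exactAt_succ_single_obj⟩

lemma lTensor_act (M : Type) [AddCommGroup M] [Module R M] {a b : ℕ}
    (A : Matrix (Fin b) (Fin a) R) (x : TensorProduct R M (Fin a → R)) :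
    TensorProduct.piScalarRight R R M (Fin b) (A.mulVecLin.lTensor M x) =
      act M A (TensorProduct.piScalarRight R R M (Fin a) x) := by
  induction x with
  | zero => simp
  | add x y hx hy => simp only [map_add, hx, hy]
  | tmul m v => 
    ext i
    simp [act_apply, Matrix.mulVec, dotProduct, Finset.sum_smul, mul_smul]

lemma tor_iff (p : ℕ → ℕ) (D : ∀ i, Matrix (Fin (p i)) (Fin (p (i + 1))) R)
    (h : ∀ i, Ex R (D (i + 1)) (D i)) (T : Type) [AddCommGroup T] [Module R T]
    (g : (Fin (p 0) → R) →ₗ[R] T) (hg : Function.Surjective g)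
    (hk : LinearMap.ker g = LinearMap.range (D 0).mulVecLin)
    (M : Type) [AddCommGroup M] [Module R M] (i : ℕ) :
    Subsingleton (TorM R (i + 1) M T) ↔ Ex M (D (i + 1)) (D i) := by
  have e := (pr p D h T g hg hk).isoLeftDerivedObj
    ((MonoidalCategory.tensoringLeft (ModuleCat R)).obj (ModuleCat.of R M)) (i + 1)
  have h1 : Subsingleton (TorM R (i + 1) M T) ↔ Limits.IsZero
    (((Tor (ModuleCat R) (i + 1)).obj (ModuleCat.of R M)).obj (ModuleCat.of R T)) :=
    ModuleCat.isZero_iff_subsingleton.symm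
  rw [h1]
  have h2 := e.isZero_iff
  refine h2.trans ?_
  refine (HomologicalComplex.exactAt_iff_isZero_homology _ _).symm.trans ?_
  rw [HomologicalComplex.exactAt_iff' _ (i + 1 + 1) (i + 1) i (by simp) (by simp),
          ShortComplex.moduleCat_exact_iff]
  have hd : ∀ k, ∀ x : TensorProduct R M (Fin (p (k+1)) → R), (ModuleCat.Hom.hom ((((MonoidalCategory.tensoringLeft (ModuleCat R)).obj
      (ModuleCat.of R M)).mapHomologicalComplex _).obj (cx p D (fun i => (h i).1))|>.d (k+1) k)) x
      = (D k).mulVecLin.lTensor M x := by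
    intro k x
    change (ModuleCat.Hom.hom (MonoidalCategory.whiskerLeft (ModuleCat.of R M) ((cx p D (fun i => (h i).1)).d (k+1) k))) x = _
    rw [cx_d]
    rfl
  have key : (∀ x : TensorProduct R M (Fin (p (i+1)) → R), (D i).mulVecLin.lTensor M x = 0 →
      ∃ y : TensorProduct R M (Fin (p (i+1+1)) → R), (D (i+1)).mulVecLin.lTensor M y = x) ↔
      Ex M (D (i + 1)) (D i) := by
    constructor
    · intro H
      refine ⟨(h i).1, fun x hx => ?_⟩
      obtain ⟨y, hy⟩ := H ((TensorProduct.piScalarRight R R M _).symm x) (by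
        apply (TensorProduct.piScalarRight R R M _).injective
        rw [lTensor_act]
        simpa using hx)
      refine ⟨TensorProduct.piScalarRight R R M _ y, ?_⟩
      rw [← lTensor_act, hy]
      exact LinearEquiv.apply_symm_apply _ _
    · intro H x hx
      obtain ⟨y, hy⟩ := H.2 (TensorProduct.piScalarRight R R M _ x) (by
        rw [← lTensor_act, hx]; exact map_zero _)
      refine ⟨(TensorProduct.piScalarRight R R M _).symm y, ?_⟩
      apply (TensorProduct.piScalarRight R R M _).injective
      rw [lTensor_act]
      simpa using hy
  rw [← key]
  constructor
  · intro H x hx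
    obtain ⟨y, hy⟩ := H x ((hd i x).trans hx)
    exact ⟨y, (hd (i+1) y).symm.trans hy⟩
  · intro H x hx
    obtain ⟨y, hy⟩ := H x ((hd i x).symm.trans hx)
    exact ⟨y, (hd (i+1) y).trans hy⟩

lemma ext_vanish (p : ℕ → ℕ) (D : ∀ i, Matrix (Fin (p i)) (Fin (p (i + 1))) R)
    (h : ∀ i, Ex R (D (i + 1)) (D i)) (T : Type) [AddCommGroup T] [Module R T]
    (g : (Fin (p 0) → R) →ₗ[R] T) (hg : Function.Surjective g)
    (hk : LinearMap.ker g = LinearMap.range (D 0).mulVecLin)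
    (M : Type) [AddCommGroup M] [Module R M] (i : ℕ) (he : Subsingleton (ExtM R i T M))
    (f : (Fin (p i) → R) →ₗ[R] M) (hf : f ∘ₗ (D i).mulVecLin = 0) :
    match i, f with
    | 0, f => f = 0
    | i + 1, f => ∃ f' : (Fin (p i) → R) →ₗ[R] M, f = f' ∘ₗ (D i).mulVecLin := by
  have e := (pr p D h T g hg hk).isoExt (R := R) i (ModuleCat.of R M)
  have h1 : Limits.IsZero (((Ext R (ModuleCat R) i).obj (Opposite.op (ModuleCat.of R T))).obj (ModuleCat.of R M)) :=
    ModuleCat.isZero_iff_subsingleton.2 he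
  have h2 := (HomologicalComplex.exactAt_iff_isZero_homology _ _).2 (e.isZero_iff.1 h1)
  have hd : ∀ k, ∀ x : ModuleCat.of R (Fin (p k) → R) ⟶ ModuleCat.of R M, 
     (ModuleCat.Hom.hom (((cx p D (fun i => (h i).1)).linearYonedaObj R (ModuleCat.of R M)).d k (k+1))) x
      = (ModuleCat.ofHom (D k).mulVecLin ≫ x : _) := by
    intro k x
    rw [← cx_d p D (fun i => (h i).1)]
    rfl
  have hz : (ModuleCat.ofHom (D i).mulVecLin ≫ ModuleCat.ofHom f : _) = 0 := by
    rw [← ModuleCat.ofHom_comp, hf]; rfl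
  cases i with
  | zero =>
    rw [HomologicalComplex.exactAt_iff' _ 0 0 1 (by simp) (by simp),
          ShortComplex.moduleCat_exact_iff] at h2
    obtain ⟨y, hy⟩ := h2 (ModuleCat.ofHom f) ((hd 0 _).trans hz)
    have : ((cx p D (fun i => (h i).1)).linearYonedaObj R (ModuleCat.of R M)).d 0 0 = 0 :=
      HomologicalComplex.shape _ _ _ (by simp)
    change (ModuleCat.Hom.hom (((cx p D (fun i => (h i).1)).linearYonedaObj R (ModuleCat.of R M)).d 0 0)) y = _ at hy
    rw [this] at hy
    have h3 : ModuleCat.ofHom f = 0 := hy.symm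
    exact congrArg ModuleCat.Hom.hom h3
  | succ i =>
    rw [HomologicalComplex.exactAt_iff' _ i (i+1) (i+2) (by simp) (by simp),
          ShortComplex.moduleCat_exact_iff] at h2
    obtain ⟨y, hy⟩ := h2 (ModuleCat.ofHom f) ((hd (i+1) _).trans hz)
    have h3 := (hd i y).symm.trans hy
    exact ⟨y.hom, (congrArg ModuleCat.Hom.hom h3).symm⟩
lemma gen_matrix [IsNoetherianRing R] (c : ℕ) (K : Submodule R (Fin c → R)) :
    ∃ (a : ℕ) (e : Matrix (Fin c) (Fin a) R), LinearMap.range e.mulVecLin = K := by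
  obtain ⟨a, s, hs⟩ := Submodule.fg_iff_exists_fin_generating_family.1 (IsNoetherian.noetherian K)
  refine ⟨a, Matrix.of fun i j => s j i, ?_⟩
  rw [Matrix.range_mulVecLin, ← hs]
  rfl

lemma ex_of_range {a b c : ℕ} (A : Matrix (Fin b) (Fin a) R) (B : Matrix (Fin c) (Fin b) R)
    (h : LinearMap.range A.mulVecLin = LinearMap.ker B.mulVecLin) : Ex R A B := by
  constructor
  · have h1 := LinearMap.range_le_ker_iff.1 h.le
    rw [← Matrix.mulVecLin_mul] at h1
    apply Matrix.toLin'.injective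
    rw [Matrix.toLin'_apply', h1, map_zero]
  · intro x hx
    rw [act_R] at hx
    have : x ∈ LinearMap.range A.mulVecLin := by rw [h]; exact hx
    obtain ⟨y, hy⟩ := this
    exact ⟨y, by rw [act_R]; exact hy⟩

lemma range_of_ex {a b c : ℕ} (A : Matrix (Fin b) (Fin a) R) (B : Matrix (Fin c) (Fin b) R)
    (h : Ex R A B) : LinearMap.range A.mulVecLin = LinearMap.ker B.mulVecLin := by
  apply le_antisymm
  · rw [LinearMap.range_le_ker_iff, ← Matrix.mulVecLin_mul, h.1]
    simp
  · intro x hx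
    obtain ⟨y, hy⟩ := h.2 x (by rw [act_R]; exact hx)
    exact ⟨y, by rw [← act_R]; exact hy⟩

lemma exists_res [IsNoetherianRing R] (c : ℕ) (K : Submodule R (Fin c → R)) :
    ∃ (p : ℕ → ℕ) (e : Matrix (Fin c) (Fin (p 0)) R)
      (D : ∀ i, Matrix (Fin (p i)) (Fin (p (i + 1))) R),
      LinearMap.range e.mulVecLin = K ∧ Ex R (D 0) e ∧ ∀ i, Ex R (D (i + 1)) (D i) := by
  choose a e he using gen_matrix (R := R)
  let s : ℕ → Σ c : ℕ, Submodule R (Fin c → R) := fun i => Nat.rec ⟨c, K⟩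
    (fun _ x => ⟨a x.1 x.2, LinearMap.ker (e x.1 x.2).mulVecLin⟩) i
  refine ⟨fun i => (s (i + 1)).1, e c K, fun i => e (s (i + 1)).1 (s (i + 1)).2, he _ _, ?_, ?_⟩
  · exact ex_of_range _ _ (he _ _)
  · intro i
    exact ex_of_range _ _ (he _ _)

/-- add a matrix at the front of a sequence of matrices -/
def consP (c : ℕ) (p : ℕ → ℕ) : ℕ → ℕ
  | 0 => c
  | i + 1 => p i

/-- add a matrix at the front of a sequence of matrices -/
def consD (c : ℕ) (p : ℕ → ℕ) (e : Matrix (Fin c) (Fin (p 0)) R)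
    (D : ∀ i, Matrix (Fin (p i)) (Fin (p (i + 1))) R) :
    ∀ i, Matrix (Fin (consP c p i)) (Fin (consP c p (i + 1))) R
  | 0 => e
  | i + 1 => D i

lemma consD_ex (c : ℕ) (p : ℕ → ℕ) (e : Matrix (Fin c) (Fin (p 0)) R)
    (D : ∀ i, Matrix (Fin (p i)) (Fin (p (i + 1))) R) 
    (h0 : Ex R (D 0) e) (h : ∀ i, Ex R (D (i + 1)) (D i)) (i : ℕ) :
    Ex R (consD c p e D (i + 1)) (consD c p e D i) := by
  cases i with
  | zero => exact h0
  | succ i => exact h i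

lemma ex_pi {a b c : ℕ} (A : Matrix (Fin b) (Fin a) R) (B : Matrix (Fin c) (Fin b) R)
    (h : Ex R A B) (m : ℕ) : Ex (Fin m → R) A B := by
  refine ⟨h.1, fun x hx => ?_⟩
  have : ∀ k : Fin m, ∃ y : Fin a → R, act R A y = fun i => x i k := by
    intro k
    apply h.2
    have := act_comp (R := R) (LinearMap.proj k : (Fin m → R) →ₗ[R] R) B x
    refine this.trans ?_
    rw [hx]
    rfl
  choose y hy using this
  refine ⟨fun j k => y k j, ?_⟩
  ext i k
  have := congrFun (act_comp (R := R) (LinearMap.proj k : (Fin m → R) →ₗ[R] R) A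
    (fun j k => y k j)) i
  refine this.symm.trans ?_
  exact congrFun (hy k) i

lemma ex_equiv {N N' : Type} [AddCommGroup N] [Module R N] [AddCommGroup N'] [Module R N']
    (φ : N ≃ₗ[R] N') {a b c : ℕ} (A : Matrix (Fin b) (Fin a) R) (B : Matrix (Fin c) (Fin b) R)
    (h : Ex N A B) : Ex N' A B := by
  refine ⟨h.1, fun x hx => ?_⟩
  obtain ⟨y, hy⟩ := h.2 (fun i => φ.symm (x i)) (by
    refine (act_comp φ.symm.toLinearMap B x).trans ?_
    rw [hx]
    ext; simp)
  refine ⟨fun j => φ (y j), ?_⟩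
  refine (act_comp φ.toLinearMap A y).trans ?_
  rw [hy]
  ext; simp

lemma ex_ker {N : Type} [AddCommGroup N] [Module R N] (m : ℕ) (g : (Fin m → R) →ₗ[R] N)
    (hg : Function.Surjective g) {a b c d : ℕ} (A : Matrix (Fin b) (Fin a) R)
    (B : Matrix (Fin c) (Fin b) R) (C : Matrix (Fin d) (Fin c) R)
    (h1 : Ex R B C) (h0 : B * A = 0) (h : Ex N A B) : Ex (LinearMap.ker g) B C := by
  refine ⟨h1.1, fun x hx => ?_⟩
  obtain ⟨y, hy⟩ := (ex_pi B C h1 m).2 (fun i => (x i : Fin m → R)) (by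
    refine (act_comp (LinearMap.ker g).subtype C x).trans ?_
    rw [hx]; rfl)
  obtain ⟨z, hz⟩ := h.2 (fun i => g (y i)) (by
    rw [act_comp, hy]
    ext i
    exact (x i).2)
  choose w hw using fun i => hg (z i)
  have hgw : ∀ i, g (y i - act _ A w i) = 0 := by
    intro i
    have h2 := congrFun (act_comp g A w) i
    simp only [hw] at h2
    rw [map_sub, ← h2, hz]
    simp
  refine ⟨fun i => ⟨y i - act _ A w i, hgw i⟩, ?_⟩
  ext1 i
  apply Subtype.ext
  have h3 := congrFun (act_comp (LinearMap.ker g).subtype B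
    (fun i => ⟨y i - act _ A w i, hgw i⟩)) i
  refine h3.symm.trans ?_
  change act _ B (y - act _ A w) i = _
  rw [map_sub, hy, ← act_mul, h0, act_zero, sub_zero]

lemma ker_res {N : Type} [AddCommGroup N] [Module R N] (m : ℕ → ℕ)
    (A : ∀ i, Matrix (Fin (m i)) (Fin (m (i + 1))) R)
    (hA : ∀ i, Ex R (A (i + 1)) (A i))
    (g : (Fin (m 0) → R) →ₗ[R] N)
    (hk : LinearMap.ker g = LinearMap.range (A 0).mulVecLin) :
    ∃ g' : (Fin (m 1) → R) →ₗ[R] LinearMap.ker g, Function.Surjective g' ∧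
      LinearMap.ker g' = LinearMap.range (A 1).mulVecLin := by
  refine ⟨(A 0).mulVecLin.codRestrict _ (fun x => by rw [hk]; exact ⟨x, rfl⟩), ?_, ?_⟩
  · rintro ⟨x, hx⟩
    rw [hk] at hx
    obtain ⟨y, hy⟩ := hx
    exact ⟨y, Subtype.ext hy⟩
  · rw [LinearMap.ker_codRestrict]
    exact (range_of_ex _ _ (hA 0)).symm

lemma ex_syz (p : ℕ → ℕ) (D : ∀ i, Matrix (Fin (p i)) (Fin (p (i + 1))) R)
    (hD : ∀ i, Ex R (D (i + 1)) (D i)) (j : ℕ) :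
    ∀ (N : Type) [AddCommGroup N] [Module R N] (m : ℕ → ℕ)
    (A : ∀ i, Matrix (Fin (m i)) (Fin (m (i + 1))) R)
    (_ : ∀ i, Ex R (A (i + 1)) (A i))
    (g : (Fin (m 0) → R) →ₗ[R] N) (_ : Function.Surjective g)
    (_ : LinearMap.ker g = LinearMap.range (A 0).mulVecLin)
    (_ : ∀ i, Ex N (D (i + 1)) (D i)) (i : ℕ),
    Ex ((Fin (m j) → R) ⧸ LinearMap.range (A j).mulVecLin) (D (i + 1)) (D i) := by
  induction j with
  | zero =>
    intro N _ _ m A hA g hg hk hN i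
    rw [← hk]
    exact ex_equiv (g.quotKerEquivOfSurjective hg).symm _ _ (hN i)
  | succ j ih =>
    intro N _ _ m A hA g hg hk hN i
    obtain ⟨g', hg', hk'⟩ := ker_res m A hA g hk
    exact ih (LinearMap.ker g) (fun i => m (i + 1)) (fun i => A (i + 1)) (fun i => hA (i + 1))
      g' hg' hk' (fun i => ex_ker _ g hg _ _ _ (hD i) (hD (i + 1)).1 (hN (i + 1))) i

lemma pd_of_free [IsLocalRing R] (j : ℕ) :
    ∀ (N : Type) [AddCommGroup N] [Module R N] (m : ℕ → ℕ)
    (A : ∀ i, Matrix (Fin (m i)) (Fin (m (i + 1))) R)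
    (_ : ∀ i, Ex R (A (i + 1)) (A i))
    (g : (Fin (m 0) → R) →ₗ[R] N) (_ : Function.Surjective g)
    (_ : LinearMap.ker g = LinearMap.range (A 0).mulVecLin)
    (_ : Module.Free R ((Fin (m j) → R) ⧸ LinearMap.range (A j).mulVecLin)), PdLE R N j := by
  induction j with
  | zero =>
    intro N _ _ m A hA g hg hk hN
    rw [← hk] at hN
    have : Module.Free R N := Module.Free.of_equiv (g.quotKerEquivOfSurjective hg)
    have : Module.Finite R N := Module.Finite.of_surjective g hg
    let b := Module.finBasis R N
    refine ⟨fun i => Nat.casesOn i (Module.finrank R N) (fun _ => 0), fun i => 0,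
      b.equivFun.symm.toLinearMap, b.equivFun.symm.surjective, ?_, ?_, ?_⟩
    · rw [LinearEquiv.ker, LinearMap.range_zero]
    · intro i
      have : Subsingleton (Fin (Nat.casesOn (i + 1) (Module.finrank R N) (fun _ => 0) : ℕ) → R) :=
        inferInstanceAs (Subsingleton (Fin 0 → R))
      exact Subsingleton.elim _ _
    · intro i hi
      cases i with
      | zero => exact absurd hi (lt_irrefl _)
      | succ i => rfl
  | succ j ih =>
    intro N _ _ m A hA g hg hk hN
    obtain ⟨g', hg', hk'⟩ := ker_res m A hA g hk
    obtain ⟨n, d, f, hf, hfk, hd, hn⟩ := ih (LinearMap.ker g) (fun i => m (i + 1))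
      (fun i => A (i + 1)) (fun i => hA (i + 1)) g' hg' hk' hN
    refine ⟨consP (m 0) n, fun i => match i with
      | 0 => (LinearMap.ker g).subtype ∘ₗ f
      | i + 1 => d i, g, hg, ?_, ?_, ?_⟩
    · change _ = LinearMap.range ((LinearMap.ker g).subtype ∘ₗ f)
      rw [LinearMap.range_comp, LinearMap.range_eq_top.2 hf]
      simp
      rfl
    · intro i
      match i with
      | 0 =>
        change LinearMap.ker ((LinearMap.ker g).subtype ∘ₗ f) = LinearMap.range (d 0)
        rw [← hfk, LinearMap.ker_comp]
        simp
      | i + 1 => exact hd i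
    · intro i hi
      match i with
      | 0 => omega
      | i + 1 => exact hn i (by omega)

lemma exists_factor {a b c : ℕ} (A : Matrix (Fin b) (Fin a) R) (B : Matrix (Fin b) (Fin c) R)
    (h : LinearMap.range B.mulVecLin ≤ LinearMap.range A.mulVecLin) :
    ∃ C : Matrix (Fin a) (Fin c) R, B = A * C := by
  have : ∀ j : Fin c, ∃ y : Fin a → R, A *ᵥ y = fun i => B i j := by
    intro j
    have h1 : B.mulVecLin (Pi.single j 1) ∈ LinearMap.range A.mulVecLin := h ⟨_, rfl⟩
    obtain ⟨y, hy⟩ := h1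
    refine ⟨y, ?_⟩
    rw [← Matrix.mulVecLin_apply, hy]
    ext i
    simp
  choose y hy using this
  refine ⟨Matrix.of fun i j => y j i, ?_⟩
  ext i j
  have := congrFun (hy j) i
  rw [← this]
  rfl

lemma exists_residue [IsLocalRing R] (M : Type) [AddCommGroup M] [Module R M] [Module.Finite R M]
    [Nontrivial M] : ∃ φ : M →ₗ[R] (R ⧸ maximalIdeal R), Function.Surjective φ := by
  obtain ⟨N, hN⟩ := IsCoatomic.exists_coatom (Submodule R M)
  have hs : IsSimpleModule R (M ⧸ N) := isSimpleModule_iff_isCoatom.2 hN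
  obtain ⟨I, hI, ⟨e⟩⟩ := isSimpleModule_iff_quot_maximal.1 hs
  rw [IsLocalRing.eq_maximalIdeal hI] at e
  exact ⟨e.toLinearMap ∘ₗ N.mkQ, e.surjective.comp N.mkQ_surjective⟩

lemma mem_smul_pi (I : Ideal R) {c : ℕ} (v : Fin c → R) (h : ∀ i, v i ∈ I) :
    v ∈ I • (⊤ : Submodule R (Fin c → R)) := by
  rw [pi_eq_sum_univ' v]
  exact Submodule.sum_mem _ fun i _ => Submodule.smul_mem_smul (h i) trivial

lemma surj_of_act [IsLocalRing R] (M : Type) [AddCommGroup M] [Module R M] [Module.Finite R M]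
    [Nontrivial M] {a b c : ℕ} (C : Matrix (Fin c) (Fin a) R) (D : Matrix (Fin c) (Fin b) R)
    (h : ∀ x : Fin c → M, ∃ y z, x = act M C y + act M D z) :
    LinearMap.range C.mulVecLin ⊔ LinearMap.range D.mulVecLin = ⊤ := by
  obtain ⟨φ, hφ⟩ := exists_residue (R := R) M
  rw [eq_top_iff]
  apply Submodule.le_of_le_smul_of_le_jacobson_bot (I := maximalIdeal R) Module.Finite.fg_top
    (IsLocalRing.maximalIdeal_le_jacobson _)
  intro v _
  choose x hx using fun i => hφ (Ideal.Quotient.mk _ (v i))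
  obtain ⟨y, z, hyz⟩ := h x
  choose y' hy' using fun i => Ideal.Quotient.mk_surjective (φ (y i))
  choose z' hz' using fun i => Ideal.Quotient.mk_surjective (φ (z i))
  have hmem : v - (C *ᵥ y' + D *ᵥ z') ∈ (maximalIdeal R) • (⊤ : Submodule R (Fin c → R)) := by
    apply mem_smul_pi
    intro i
    rw [← Ideal.Quotient.eq_zero_iff_mem]
    have h1 := congrArg φ (congrFun hyz i)
    simp only [Pi.add_apply, map_add, hx, act_apply, map_sum, map_smul, ← hy', ← hz'] at h1
    simp only [Pi.sub_apply, Pi.add_apply, map_sub, map_add, h1, Matrix.mulVec, dotProduct,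
      map_sum, map_mul]
    simp only [Algebra.smul_def]
    exact sub_self _
  rw [show v = (C *ᵥ y' + D *ᵥ z') + (v - (C *ᵥ y' + D *ᵥ z')) by abel]
  exact Submodule.add_mem_sup (Submodule.add_mem_sup ⟨y', rfl⟩ ⟨z', rfl⟩) hmem
lemma free_of_ex [IsLocalRing R] {a b c : ℕ} (A : Matrix (Fin b) (Fin a) R)
    (D : Matrix (Fin b) (Fin c) R)
    (h : Ex ((Fin b → R) ⧸ LinearMap.range A.mulVecLin) D Aᵀ) :
    Module.Free R ((Fin b → R) ⧸ LinearMap.range A.mulVecLin) := by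
  set K := LinearMap.range A.mulVecLin with hK
  obtain ⟨z, hz⟩ := h.2 (fun i => K.mkQ (Pi.single i 1)) (by
    refine (act_comp K.mkQ Aᵀ (fun i => Pi.single i 1)).trans ?_
    ext k
    change K.mkQ _ = 0
    rw [Submodule.mkQ_apply, Submodule.Quotient.mk_eq_zero]
    refine ⟨Pi.single k 1, ?_⟩
    ext i
    simp [act_apply, Finset.sum_apply, Pi.single_apply])
  have hle : K ≤ LinearMap.ker Dᵀ.mulVecLin := by
    rw [hK, LinearMap.range_le_ker_iff, ← Matrix.mulVecLin_mul]
    have : Dᵀ * A = (Aᵀ * D)ᵀ := by simp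
    rw [this, h.1]
    simp
  let σ : ((Fin b → R) ⧸ K) →ₗ[R] (Fin c → R) := K.liftQ Dᵀ.mulVecLin hle
  let τ : (Fin c → R) →ₗ[R] ((Fin b → R) ⧸ K) := Fintype.linearCombination R z
  have hst : τ ∘ₗ σ = LinearMap.id := by
    apply Submodule.linearMap_qext
    apply (Pi.basisFun R (Fin b)).ext
    intro i
    have := congrFun hz i
    simp only [act_apply] at this
    simp only [LinearMap.comp_apply, LinearMap.id_apply, Pi.basisFun_apply]
    refine Eq.trans ?_ this
    simp [σ, τ, Fintype.linearCombination_apply]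
  have : Module.Projective R ((Fin b → R) ⧸ K) := Module.Projective.of_split σ τ hst
  exact Module.free_of_flat_of_isLocalRing

lemma main [IsNoetherianRing R] [IsLocalRing R] (M : Type) [AddCommGroup M] [Module R M]
    [Module.Finite R M]
    (hrig : ∀ (N : Type) [AddCommGroup N] [Module R N] [Module.Finite R N] (r : ℕ), 1 ≤ r →
      Subsingleton (TorM R r M N) → ∀ j : ℕ, r ≤ j → Subsingleton (TorM R j M N))
    (n : ℕ) (hext : Subsingleton (ExtM R n M M)) :
    Subsingleton M ∨ ∃ k : ℕ, k < n ∧ PdLE R M k := by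
  obtain ⟨c, g, hg⟩ := Module.Finite.exists_fin' R M
  obtain ⟨p, e, D, he, hDe, hD⟩ := exists_res c (LinearMap.ker g)
  obtain ⟨m, A, hA, g, hg, hk⟩ : ∃ (m : ℕ → ℕ) (A : ∀ i, Matrix (Fin (m i)) (Fin (m (i + 1))) R)
      (_ : ∀ i, Ex R (A (i + 1)) (A i)) (g : (Fin (m 0) → R) →ₗ[R] M), Function.Surjective g ∧ 
      LinearMap.ker g = LinearMap.range (A 0).mulVecLin :=
    ⟨consP c p, consD c p e D, consD_ex c p e D hDe hD, g, hg, he.symm⟩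
  have hE := ext_vanish m A hA M g hg hk M n hext
  cases n with
  | zero =>
    left
    have h0 := hE g (LinearMap.range_le_ker_iff.1 hk.ge)
    refine subsingleton_of_forall_eq 0 fun x => ?_
    obtain ⟨y, rfl⟩ := hg x
    simp [h0]
  | succ s =>
    rcases subsingleton_or_nontrivial M with hM | hM
    · exact Or.inl hM
    right
    refine ⟨s, Nat.lt_succ_self s, pd_of_free s M m A hA g hg hk ?_⟩
    -- the dual sequence
    have hB : Ex M (A s)ᵀ (A (s + 1))ᵀ := by
      refine ⟨by rw [← Matrix.transpose_mul, (hA s).1]; simp, fun x hx => ?_⟩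
      obtain ⟨f, hf⟩ := hE (Fintype.linearCombination R x) (by
        apply (Pi.basisFun R _).ext
        intro i
        have := congrFun hx i
        simp only [act_apply] at this
        simpa [Fintype.linearCombination_apply] using this)
      refine ⟨fun i => f (Pi.single i 1), ?_⟩
      ext j
      have h1 := LinearMap.congr_fun hf (Pi.single j 1)
      simp only [Fintype.linearCombination_apply_single, one_smul] at h1
      rw [h1]
      simp only [act_apply, LinearMap.comp_apply, Matrix.mulVecLin_apply, Matrix.mulVec_single_one]
      conv_rhs => rw [pi_eq_sum_univ' ((A s).col j)]
      simp
    set B1 := (A s)ᵀ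
    set B0 := (A (s + 1))ᵀ
    let T := (Fin (m (s + 2)) → R) ⧸ LinearMap.range B0.mulVecLin
    obtain ⟨p, D1, D, hD1, hDD1, hDD⟩ := exists_res _ (LinearMap.ker B0.mulVecLin)
    have hP1 := consD_ex _ p D1 D hDD1 hDD
    have hP := consD_ex (m (s + 2)) (consP _ p) B0 (consD _ p D1 D) (ex_of_range _ _ hD1) hP1
    have tor := tor_iff _ _ hP T (Submodule.mkQ _) (Submodule.mkQ_surjective _)
      (Submodule.ker_mkQ _) M
    obtain ⟨C, hC⟩ := exists_factor D1 B1 (by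
      rw [hD1, LinearMap.range_le_ker_iff, ← Matrix.mulVecLin_mul, hB.1]; simp)
    have t1 : Subsingleton (TorM R (0 + 1) M T) := by
      refine (tor 0).2 ⟨(hP 0).1, fun x hx => ?_⟩
      obtain ⟨y, hy⟩ := hB.2 x hx
      refine ⟨act M C y, ?_⟩
      refine Eq.trans ?_ hy
      rw [hC]
      exact (act_mul M C D1 y).symm
    have tall : ∀ i, Subsingleton (TorM R (i + 1) M T) := fun i =>
      hrig T 1 le_rfl t1 (i + 1) (by omega)
    have t2 : Ex M (D 0) D1 := (tor 1).1 (tall 1)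
    have hsur := surj_of_act M C (D 0) (by
      intro x
      have h0 : act M B0 (act M D1 x) = 0 := by
        rw [← act_mul, (ex_of_range D1 B0 hD1).1, act_zero]
      obtain ⟨y, hy⟩ := hB.2 _ h0
      rw [hC, act_mul] at hy
      obtain ⟨z, hz⟩ := t2.2 (x - act M C y) (by rw [map_sub, hy, sub_self])
      exact ⟨y, z, by rw [hz]; abel⟩)
    have hR : LinearMap.range B1.mulVecLin = LinearMap.ker B0.mulVecLin := by
      have h1 : LinearMap.range D1.mulVecLin = LinearMap.range B1.mulVecLin := by
        rw [LinearMap.range_eq_map, ← hsur, Submodule.map_sup, ← LinearMap.range_comp,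
          ← LinearMap.range_comp, ← Matrix.mulVecLin_mul, ← Matrix.mulVecLin_mul, ← hC, hDD1.1]
        simp
      rw [← h1, hD1]
    obtain ⟨q, E1, E, hE1, hEE1, hEE⟩ := exists_res _ (LinearMap.ker B1.mulVecLin)
    have hQ1 := consD_ex _ q E1 E hEE1 hEE
    have hQ2 := consD_ex _ (consP _ q) B1 (consD _ q E1 E) (ex_of_range _ _ hE1) hQ1
    have hQ := consD_ex (m (s + 2)) (consP _ (consP _ q)) B0 (consD _ (consP _ q) B1 (consD _ q E1 E))
      (ex_of_range _ _ hR) hQ2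
    have tor' := tor_iff _ _ hQ T (Submodule.mkQ _) (Submodule.mkQ_surjective _)
      (Submodule.ker_mkQ _) M
    have hex := ex_syz _ _ hQ s M m A hA g hg hk (fun i => (tor' i).1 (tall i)) 1
    exact free_of_ex (A s) E1 hex

lemma periodic [IsLocalRing R] [IsNoetherianRing R] (M : Type) [AddCommGroup M] [Module R M]
    (hM : Module.Projective R M) (h : IsPeriodicSyzygy R M 2) : Subsingleton M := by
  obtain ⟨n, d, g, hg, hk, hd, hkm, hdm, ⟨φ⟩⟩ := h
  obtain ⟨s, hs⟩ := Module.projective_lifting_property g LinearMap.id hg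
  have hgs : ∀ x, g (s x) = x := fun x => LinearMap.congr_fun hs x
  have hJ := IsLocalRing.maximalIdeal_le_jacobson (R := R) ⊥
  let π : (Fin (n 0) → R) →ₗ[R] (Fin (n 0) → R) := LinearMap.id - s ∘ₗ g
  have hπ : LinearMap.range π ≤ LinearMap.ker g := by
    rintro _ ⟨x, rfl⟩
    simp [π, hgs]
  have hker : LinearMap.ker g = ⊥ := by
    apply Submodule.eq_bot_of_le_smul_of_le_jacobson_bot (maximalIdeal R) _
      (IsNoetherian.noetherian _) _ hJ
    intro x hx
    have h1 : π x ∈ Submodule.map π ((maximalIdeal R) • ⊤) := ⟨x, hkm hx, rfl⟩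
    rw [Submodule.map_smul''] at h1
    have h2 : π x = x := by
      have : g x = 0 := hx
      simp [π, this]
    rw [h2] at h1
    refine Submodule.smul_mono le_rfl ?_ h1
    rw [← LinearMap.range_eq_map]
    exact hπ
  have hd0 : LinearMap.ker (d 0) = ⊤ := by
    rw [LinearMap.ker_eq_top, ← LinearMap.range_eq_bot, ← hk, hker]
  have htop : (⊤ : Submodule R (Fin (n 1) → R)) = ⊥ := by
    apply Submodule.eq_bot_of_le_smul_of_le_jacobson_bot (maximalIdeal R) _
      (IsNoetherian.noetherian _) _ hJ
    rw [← hd0, hd 0]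
    refine (hdm 1).trans ?_
    exact Submodule.smul_mono le_rfl (by rw [← hd, hd0])
  have : Subsingleton (Fin (n 1) → R) := by
    rw [← Submodule.subsingleton_iff R]
    exact subsingleton_of_bot_eq_top htop.symm
  have : Subsingleton (LinearMap.range (d 1)) := inferInstance
  exact φ.injective.subsingleton

lemma proj_of_pd (M : Type) [AddCommGroup M] [Module R M] (h : PdLE R M 0) :
    Module.Projective R M := by
  obtain ⟨n, d, g, hg, hk, hd, hn⟩ := h
  have h1 : n 1 = 0 := hn 1 one_pos
  have h2 : IsEmpty (Fin (n (0 + 1))) := by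
    rw [Nat.zero_add, h1]; infer_instance
  have : LinearMap.range (d 0) = ⊥ := by
    rw [LinearMap.range_eq_bot]
    exact Subsingleton.elim _ _
  have e := LinearEquiv.ofBijective g ⟨LinearMap.ker_eq_bot.1 (hk.trans this), hg⟩
  exact Module.Projective.of_equiv e
end
end TR

theorem pd_lt_of_ext_self_vanishes_tor_rigid
    (R : Type) [CommRing R] [IsNoetherianRing R] [IsLocalRing R]
    (M : Type) [AddCommGroup M] [Module R M] [Module.Finite R M]
    
    (hrig : ∀ (N : Type) [AddCommGroup N] [Module R N] [Module.Finite R N] (r : ℕ), 1 ≤ r →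
      Subsingleton (TorM R r M N) → ∀ j : ℕ, r ≤ j → Subsingleton (TorM R j M N))
    (n : ℕ) (hext : Subsingleton (ExtM R n M M)) :
    (Subsingleton M ∨ ∃ k : ℕ, k < n ∧ PdLE R M k) ∧
    (n = 1 → IsPeriodicSyzygy R M 2 → Subsingleton M) := by
  have h := TR.main M hrig n hext
  refine ⟨h, fun hn hp => ?_⟩
  rcases h with h | ⟨k, hk, h⟩
  · exact h
  · obtain rfl : k = 0 := by omega
    exact TR.periodic M (TR.proj_of_pd M h) hp
end
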